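/- arXiv:2310.18125 — 4 statements merged into one kernel-verified Lean document; each statement's English description precedes it below -/
import Mathlib

section
/- Let Γ be a countable discrete group, let A and B be separable unital C*-algebras, and let α: Γ → Aut(A) and β: Γ → Aut(B) be actions. Let (φ, v): (A, α) → (B, β) and (ψ, w): (B, β) → (A, α) be cocycle morphisms such that the composition (ψ, w) ∘ (φ, v) is approximately unitarily equivalent to the identity cocycle morphism on (A, α) and (φ, v) ∘ (ψ, w) is approximately unitarily equivalent to the identity cocycle morphism on (B, β). Then there exists a cocycle conjugacy (Φ, V): (A, α) → (B, β) such that (Φ, V) is approximately unitarily equivalent to (φ, v) and the inverse cocycle conjugacy (Φ⁻¹, g ↦ Φ⁻¹(V_g)*) is approximately unitarily equivalent to (ψ, w). -/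
open Filter Topology

/-- `α : Γ → Aut(A)` is an action of the group `Γ` on the unital C⋆-algebra `A` by
⋆-automorphisms. -/
def IsCStarAction {Γ A : Type*} [Group Γ] [CStarAlgebra A] (α : Γ → A ≃⋆ₐ[ℂ] A) : Prop :=
  (∀ a : A, α 1 a = a) ∧ ∀ g h : Γ, ∀ a : A, α (g * h) a = α g (α h a)

/-- The cocycle conditions for a pair `(φ, v)` consisting of a map `φ : A → B` and a family of
unitaries `v : Γ → U(B)`: `v 1 = 1`, `β g (φ a) * v g = v g * φ (α g a)` and
`v (g * h) = β g (v h) * v g`. -/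
def IsCocyclePair {Γ A B : Type*} [Group Γ] [CStarAlgebra A] [CStarAlgebra B]
    (α : Γ → A ≃⋆ₐ[ℂ] A) (β : Γ → B ≃⋆ₐ[ℂ] B) (φ : A → B) (v : Γ → unitary B) : Prop :=
  v 1 = 1 ∧
  (∀ (g : Γ) (a : A), β g (φ a) * (v g : B) = (v g : B) * φ (α g a)) ∧
  (∀ g h : Γ, (v (g * h) : B) = β g (v h) * (v g : B))

/-- Approximate unitary equivalence of (formal) cocycle morphisms `(φ, v)` and `(ψ, w)` from
`(A, α)` to `(B, β)`: there are unitaries `u n ∈ U(B)` with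
`‖β g (u n) * v g * φ a * (u n)⋆  -  w g * ψ a‖ → 0` for all `g` and `a`. -/
def CocycleApproxUnitaryEquiv {Γ A B : Type*} [Group Γ] [CStarAlgebra A] [CStarAlgebra B]
    (β : Γ → B ≃⋆ₐ[ℂ] B) (φ ψ : A → B) (v w : Γ → B) : Prop :=
  ∃ u : ℕ → unitary B, ∀ (g : Γ) (a : A),
    Tendsto (fun n => ‖β g (u n) * v g * φ a * star ((u n : B)) - w g * ψ a‖) atTop (𝓝 (0 : ℝ))

/-- A not necessarily unital ⋆-homomorphism which maps `1` to `1`, as a unital ⋆-homomorphism. -/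
noncomputable def NonUnitalStarAlgHom.ofMapOne {A B : Type*} [CStarAlgebra A] [CStarAlgebra B]
    (φ : A →⋆ₙₐ[ℂ] B) (h : φ 1 = 1) : A →⋆ₐ[ℂ] B where
  toFun := φ
  map_one' := h
  map_mul' := map_mul φ
  map_zero' := map_zero φ
  map_add' := map_add φ
  commutes' r := by rw [Algebra.algebraMap_eq_smul_one, map_smul, h, Algebra.algebraMap_eq_smul_one]
  map_star' := map_star φ

section Twist

variable {Γ A B : Type*} [CStarAlgebra A] [CStarAlgebra B]

/-- The ⋆-homomorphism `Ad(u) ∘ φ`. -/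
noncomputable def twistHom (u : unitary B) (φ : A →⋆ₐ[ℂ] B) : A →⋆ₐ[ℂ] B :=
  (Unitary.conjStarAlgAut ℂ B u).toStarAlgHom.comp φ

/-- The cocycle `g ↦ β g u * v g * u⋆` of the cocycle morphism `(Ad(u) ∘ φ, _)` unitarily
equivalent to `(φ, v)`. -/
def twistCocycle (β : Γ → B ≃⋆ₐ[ℂ] B) (u : unitary B) (v : Γ → unitary B) (g : Γ) : unitary B :=
  ⟨β g u, Unitary.map_mem (β g) u.2⟩ * v g * star u

theorem twistHom_apply (u : unitary B) (φ : A →⋆ₐ[ℂ] B) (a : A) :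
    twistHom u φ a = u * φ a * star (u : B) := rfl

theorem coe_twistCocycle (β : Γ → B ≃⋆ₐ[ℂ] B) (u : unitary B) (v : Γ → unitary B) (g : Γ) :
    (twistCocycle β u v g : B) = β g u * v g * star (u : B) := rfl

theorem star_coe_mul_cancel_left (u : unitary B) (b : B) : star (u : B) * (u * b) = b := by
  rw [← mul_assoc, Unitary.coe_star_mul_self, one_mul]

variable [Group Γ]

theorem IsCocyclePair.twist {α : Γ → A ≃⋆ₐ[ℂ] A} {β : Γ → B ≃⋆ₐ[ℂ] B} (hβ : IsCStarAction β)
    {φ : A →⋆ₐ[ℂ] B} {v : Γ → unitary B} (h : IsCocyclePair α β φ v) (u : unitary B) :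
    IsCocyclePair α β (twistHom u φ) (twistCocycle β u v) := by
  obtain ⟨h1, h2, h3⟩ := h
  have hc (g : Γ) (b : B) : star (β g u) * (β g u * b) = b := by
    rw [← mul_assoc, ← map_star, ← map_mul, Unitary.coe_star_mul_self, map_one, one_mul]
  refine ⟨Subtype.ext ?_, fun g a => ?_, fun g h => ?_⟩
  · simp [coe_twistCocycle, h1, hβ.1]
  · simp only [coe_twistCocycle, twistHom_apply, map_mul, map_star, mul_assoc,
      star_coe_mul_cancel_left, hc]
    rw [← mul_assoc (β g (φ a)), h2, mul_assoc]
  · simp only [coe_twistCocycle, map_mul, map_star, mul_assoc, h3, hβ.2, hc]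

/-- If `(ψ, w) ∘ (φ, v)` is approximately unitarily equivalent to the identity, then every twist
of `(φ, v)` has a left inverse, up to a prescribed error on prescribed finite sets, among the
twists of `(ψ, w)`. -/
theorem exists_twist_approx_leftInverse {α : Γ → A ≃⋆ₐ[ℂ] A} {β : Γ → B ≃⋆ₐ[ℂ] B}
    (hα : IsCStarAction α)
    (φ : A →⋆ₐ[ℂ] B) {v : Γ → unitary B} (hv : v 1 = 1)
    (ψ : B →⋆ₐ[ℂ] A) {w : Γ → unitary A} (hψw : IsCocyclePair β α ψ w)
    (h : CocycleApproxUnitaryEquiv α (fun a => ψ (φ a)) (id : A → A)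
      (fun g => (w g : A) * ψ (v g)) (fun _ => (1 : A)))
    (x : unitary B) {F : Set A} (hF : F.Finite) {K : Set Γ} (hK : K.Finite) {ε : ℝ} (hε : 0 < ε) :
    ∃ y : unitary A, (∀ a ∈ F, ‖twistHom y ψ (twistHom x φ a) - a‖ ≤ ε) ∧
      ∀ g ∈ K, ‖(twistCocycle α y w g : A) * twistHom y ψ (twistCocycle β x v g) - 1‖ ≤ ε := by
  obtain ⟨u, hu⟩ := h
  have e1 : ∀ᶠ n in atTop, ∀ a ∈ F, _ := (eventually_all_finite hF).2 fun a _ =>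
    (hu 1 a).eventually (eventually_le_nhds hε)
  have e2 : ∀ᶠ n in atTop, ∀ g ∈ K, _ := (eventually_all_finite hK).2 fun g _ =>
    (hu g 1).eventually (eventually_le_nhds hε)
  obtain ⟨n, hn1, hn2⟩ := (e1.and e2).exists
  let ψx : unitary A := ⟨ψ x, Unitary.map_mem ψ x.2⟩
  have hψx (a : A) : star (ψ x) * (ψ x * a) = a := star_coe_mul_cancel_left ψx a
  have hψx' (a : A) : ψ x * (star (ψ x) * a) = a := by
    rw [← mul_assoc, Unitary.mul_star_self_of_mem ψx.2, one_mul]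
  have hψx1 : star (ψ x) * ψ x = 1 := Unitary.coe_star_mul_self ψx
  refine ⟨u n * star ψx, fun a ha => ?_, fun g hg => ?_⟩
  · refine le_trans (le_of_eq ?_) (hn1 a ha)
    simp [twistHom_apply, ψx, mul_assoc, hψx, hα.1, hψw.1, hv, map_star]
  · refine le_trans (le_of_eq ?_) (hn2 g hg)
    have := hψw.2.1 g x
    have hc (b : A) : star (α g (ψ x)) * (α g (ψ x) * b) = b := by
      rw [← mul_assoc, ← map_star, ← map_mul, hψx1, map_one, one_mul]
    have hw (b : A) : (w g : A) * (ψ (β g x) * b) = α g (ψ x) * (w g * b) := by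
      rw [← mul_assoc, ← this, mul_assoc]
    simp [twistHom_apply, coe_twistCocycle, ψx, mul_assoc, hψx, hψx', star_coe_mul_cancel_left, hw, hc,
      map_star]

/-- A cocycle morphism which is the pointwise limit of twists of `(φ, v)` is approximately
unitarily equivalent to `(φ, v)`. -/
theorem CocycleApproxUnitaryEquiv.of_tendsto_twist {β : Γ → B ≃⋆ₐ[ℂ] B} {φ : A →⋆ₐ[ℂ] B}
    {v : Γ → unitary B} {x : ℕ → unitary B} {Φ : A → B} {V : Γ → B}
    (hΦ : ∀ a, Tendsto (fun n => twistHom (x n) φ a) atTop (𝓝 (Φ a)))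
    (hV : ∀ g, Tendsto (fun n => (twistCocycle β (x n) v g : B)) atTop (𝓝 (V g))) :
    CocycleApproxUnitaryEquiv β Φ φ V (fun g => (v g : B)) := by
  refine ⟨fun n => star (x n), fun g a => ?_⟩
  have := (((hV g).mul (hΦ a)).const_sub (V g * Φ a)).norm
  rw [sub_self, norm_zero] at this
  refine this.congr fun n => ?_
  let y : unitary B := ⟨β g (x n), Unitary.map_mem (β g) (x n).2⟩
  rw [← CStarRing.norm_coe_unitary_mul (star y), ← CStarRing.norm_mul_coe_unitary _ (x n)]
  have hc (b : B) : star (β g (x n)) * (β g (x n) * b) = b := star_coe_mul_cancel_left y b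
  simp [y, coe_twistCocycle, twistHom_apply, mul_sub, sub_mul, mul_assoc, hc,
    star_coe_mul_cancel_left, map_star]

/-- A ⋆-homomorphism `φ` for which `ψ ∘ φ` is approximately unitarily equivalent to the
identity satisfies `ψ (φ 1) = 1`. -/
theorem CocycleApproxUnitaryEquiv.map_map_one {α : Γ → A ≃⋆ₐ[ℂ] A} (hα : IsCStarAction α)
    {φ : A →⋆ₙₐ[ℂ] B} {v : Γ → unitary B} (hv : v 1 = 1)
    {ψ : B →⋆ₙₐ[ℂ] A} {w : Γ → unitary A} (hw : w 1 = 1)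
    (h : CocycleApproxUnitaryEquiv α (fun a => ψ (φ a)) (id : A → A)
      (fun g => (w g : A) * ψ (v g)) (fun _ => (1 : A))) : ψ (φ 1) = 1 := by
  obtain ⟨u, hu⟩ := h
  have key (n : ℕ) : ‖α 1 (u n) * (w 1 * ψ (v 1)) * ψ (φ 1) * star (u n : A) - 1 * id 1‖
      = ‖ψ (φ 1) - 1‖ := by
    rw [← CStarRing.norm_coe_unitary_mul (u n) (ψ (φ 1) - 1),
      ← CStarRing.norm_mul_coe_unitary (u n * (ψ (φ 1) - 1)) (star (u n))]
    have reassoc (c : A) : ψ 1 * (ψ (φ 1) * c) = ψ (φ 1) * c := by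
      rw [← mul_assoc, ← map_mul, one_mul]
    simp [hα.1, hv, hw, mul_assoc, mul_sub, sub_mul, reassoc]
  have := tendsto_nhds_unique ((hu 1 1).congr key) tendsto_const_nhds
  exact sub_eq_zero.1 (norm_eq_zero.1 this.symm)

theorem CocycleApproxUnitaryEquiv.map_one {α : Γ → A ≃⋆ₐ[ℂ] A} (hα : IsCStarAction α)
    {φ : A →⋆ₙₐ[ℂ] B} {v : Γ → unitary B} (hv : v 1 = 1)
    {ψ : B →⋆ₙₐ[ℂ] A} {w : Γ → unitary A} (hw : w 1 = 1)
    (h : CocycleApproxUnitaryEquiv α (fun a => ψ (φ a)) (id : A → A)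
      (fun g => (w g : A) * ψ (v g)) (fun _ => (1 : A))) : ψ 1 = 1 := by
  have h1 := h.map_map_one hα hv hw
  rw [← mul_one (ψ 1), ← h1, ← map_mul, one_mul]

end Twist

section Limit

variable {A B : Type*} [CStarAlgebra A] [CStarAlgebra B]

theorem StarAlgHom.norm_map_sub_map_le (φ : A →⋆ₐ[ℂ] B) (a b : A) : ‖φ a - φ b‖ ≤ ‖a - b‖ := by
  rw [← map_sub]
  exact NonUnitalStarAlgHom.norm_apply_le φ _

theorem StarAlgHom.tendsto_apply {φ : ℕ → A →⋆ₐ[ℂ] B} {Φ : A → B}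
    (hΦ : ∀ a, Tendsto (fun n => φ n a) atTop (𝓝 (Φ a))) {c : ℕ → A} {a : A}
    (hc : Tendsto c atTop (𝓝 a)) : Tendsto (fun n => φ n (c n)) atTop (𝓝 (Φ a)) := by
  refine (hΦ a).congr_dist ?_
  rw [tendsto_iff_dist_tendsto_zero] at hc
  refine squeeze_zero (fun _ => dist_nonneg) (fun n => ?_) hc
  rw [dist_comm, dist_eq_norm, dist_eq_norm]
  exact (φ n).norm_map_sub_map_le _ _

/-- A sequence of ⋆-homomorphisms which is pointwise Cauchy on a dense sequence converges pointwise
to a ⋆-homomorphism. -/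
theorem StarAlgHom.exists_tendsto_of_cauchySeq {φ : ℕ → A →⋆ₐ[ℂ] B} {s : ℕ → A}
    (hs : DenseRange s) (h : ∀ i, CauchySeq fun n => φ n (s i)) :
    ∃ Φ : A →⋆ₐ[ℂ] B, ∀ a, Tendsto (fun n => φ n a) atTop (𝓝 (Φ a)) := by
  have hC (a : A) : CauchySeq fun n => φ n a := by
    rw [Metric.cauchySeq_iff]
    intro ε hε
    obtain ⟨i, hi⟩ := hs.exists_dist_lt a (by positivity : 0 < ε / 3)
    obtain ⟨N, hN⟩ := Metric.cauchySeq_iff.1 (h i) (ε / 3) (by positivity)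
    refine ⟨N, fun m hm n hn => ?_⟩
    have h1 := hN m hm n hn
    have h2 := (φ m).norm_map_sub_map_le a (s i)
    have h3 := (φ n).norm_map_sub_map_le a (s i)
    rw [← dist_eq_norm, ← dist_eq_norm] at h2 h3
    have h4 := dist_triangle4_right (φ m a) (φ n a) (φ m (s i)) (φ n (s i))
    linarith
  choose Φ hΦ using fun a => cauchySeq_tendsto_of_complete (hC a)
  refine ⟨{ toFun := Φ
            map_one' := tendsto_nhds_unique (hΦ 1) (by simp)
            map_mul' := fun a b => tendsto_nhds_unique (hΦ _) (by simpa using (hΦ a).mul (hΦ b))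
            map_zero' := tendsto_nhds_unique (hΦ 0) (by simp)
            map_add' := fun a b => tendsto_nhds_unique (hΦ _) (by simpa using (hΦ a).add (hΦ b))
            commutes' := fun r => tendsto_nhds_unique (hΦ _) (by
              simp only [AlgHomClass.commutes]; exact tendsto_const_nhds)
            map_star' := fun a => tendsto_nhds_unique (hΦ _) (by
              simpa [map_star] using (hΦ a).star) }, hΦ⟩

theorem cauchySeq_of_eventually_norm_sub_le {f : ℕ → A} {C : ℝ}
    (h : ∀ᶠ n in atTop, ‖f (n + 1) - f n‖ ≤ C * (1 / 2) ^ n) : CauchySeq f := by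
  refine cauchySeq_of_summable_dist (Summable.of_norm_bounded_eventually_nat
    (summable_geometric_two.mul_left C) ?_)
  filter_upwards [h] with n hn
  rwa [Real.norm_of_nonneg dist_nonneg, dist_comm, dist_eq_norm]

theorem StarAlgHom.comp_eq_id_of_tendsto {φ : ℕ → A →⋆ₐ[ℂ] B} {Φ : A →⋆ₐ[ℂ] B}
    (hΦ : ∀ a, Tendsto (fun n => φ n a) atTop (𝓝 (Φ a)))
    {ψ : ℕ → B →⋆ₐ[ℂ] A} {Ψ : B →⋆ₐ[ℂ] A}
    (hΨ : ∀ b, Tendsto (fun n => ψ n b) atTop (𝓝 (Ψ b)))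
    {s : ℕ → A} (hs : DenseRange s)
    (h : ∀ i, Tendsto (fun n => ψ n (φ n (s i))) atTop (𝓝 (s i))) :
    Ψ.comp Φ = StarAlgHom.id ℂ A := by
  have hcont : Continuous (Ψ.comp Φ) := by
    refine LipschitzWith.continuous (K := 1) (LipschitzWith.of_dist_le_mul fun a b => ?_)
    rw [dist_eq_norm, dist_eq_norm, NNReal.coe_one, one_mul]
    exact StarAlgHom.norm_map_sub_map_le _ _ _
  have := hs.equalizer hcont continuous_id (funext fun i =>
    tendsto_nhds_unique (StarAlgHom.tendsto_apply hΨ (hΦ (s i))) (h i))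
  exact StarAlgHom.ext fun a => congrFun this a

theorem norm_sub_le_of_unitary {p q r : B} (hp : p ∈ unitary B) (hr : r ∈ unitary B) :
    ‖p - r‖ ≤ ‖q * r - 1‖ + ‖p * q - 1‖ := by
  have e : p - r = -(p * (q * r - 1)) + (p * q - 1) * r := by noncomm_ring
  calc ‖p - r‖ ≤ ‖p * (q * r - 1)‖ + ‖(p * q - 1) * r‖ := by
        rw [e, ← norm_neg (p * (q * r - 1))]; exact norm_add_le _ _
    _ = _ := by
        rw [CStarRing.norm_coe_unitary_mul ⟨p, hp⟩, CStarRing.norm_mul_coe_unitary _ ⟨r, hr⟩]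

theorem tendsto_of_eventually_norm_sub_le {f : ℕ → A} {a : A}
    (h : ∀ᶠ n in atTop, ‖f n - a‖ ≤ (1 / 2) ^ n) : Tendsto f atTop (𝓝 a) := by
  rw [tendsto_iff_norm_sub_tendsto_zero]
  exact squeeze_zero' (Eventually.of_forall fun _ => norm_nonneg _) h
    (tendsto_pow_atTop_nhds_zero_of_lt_one (by norm_num) (by norm_num))

end Limit

section Intertwining

variable {Γ A B : Type*} [Group Γ] [CStarAlgebra A] [CStarAlgebra B]

theorem IsCocyclePair.of_tendsto {α : Γ → A ≃⋆ₐ[ℂ] A} {β : Γ → B ≃⋆ₐ[ℂ] B}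
    {φ : ℕ → A → B} {v : ℕ → Γ → unitary B} (h : ∀ n, IsCocyclePair α β (φ n) (v n))
    {Φ : A → B} {V : Γ → unitary B} (hΦ : ∀ a, Tendsto (fun n => φ n a) atTop (𝓝 (Φ a)))
    (hV : ∀ g, Tendsto (fun n => (v n g : B)) atTop (𝓝 (V g))) : IsCocyclePair α β Φ V := by
  have hβ (g : Γ) : Continuous (β g) := by
    refine LipschitzWith.continuous (K := 1) (LipschitzWith.of_dist_le_mul fun a b => ?_)
    rw [dist_eq_norm, dist_eq_norm, NNReal.coe_one, one_mul]
    exact StarAlgHom.norm_map_sub_map_le (β g).toStarAlgHom _ _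
  refine ⟨Subtype.ext (tendsto_nhds_unique (hV 1) ?_), fun g a => ?_, fun g k => ?_⟩
  · simp [(h _).1]
  · refine tendsto_nhds_unique ((((hβ g).tendsto _).comp (hΦ a)).mul (hV g)) ?_
    refine ((hV g).mul (hΦ (α g a))).congr fun n => ?_
    exact ((h n).2.1 g a).symm
  · refine tendsto_nhds_unique (hV (g * k)) ?_
    refine ((((hβ g).tendsto _).comp (hV k)).mul (hV g)).congr fun n => ?_
    exact ((h n).2.2 g k).symm

/-- The back-and-forth construction: sequences of twists of `(φ, v)` and `(ψ, w)` such that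
consecutive ones are mutually inverse up to an error `(1 / 2) ^ n` on prescribed finite sets, which
may depend on the twists chosen before. -/
theorem exists_twist_seq {α : Γ → A ≃⋆ₐ[ℂ] A} {β : Γ → B ≃⋆ₐ[ℂ] B}
    (hα : IsCStarAction α) (hβ : IsCStarAction β)
    {φ : A →⋆ₐ[ℂ] B} {v : Γ → unitary B} (hφv : IsCocyclePair α β φ v)
    {ψ : B →⋆ₐ[ℂ] A} {w : Γ → unitary A} (hψw : IsCocyclePair β α ψ w)
    (h1 : CocycleApproxUnitaryEquiv α (fun a => ψ (φ a)) (id : A → A)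
      (fun g => (w g : A) * ψ (v g)) (fun _ => (1 : A)))
    (h2 : CocycleApproxUnitaryEquiv β (fun b => φ (ψ b)) (id : B → B)
      (fun g => (v g : B) * φ (w g)) (fun _ => (1 : B)))
    {F : ℕ → unitary A → Set A} (hF : ∀ n y, (F n y).Finite)
    {G : ℕ → unitary B → Set B} (hG : ∀ n x, (G n x).Finite)
    {K : ℕ → Set Γ} (hK : ∀ n, (K n).Finite) :
    ∃ (x : ℕ → unitary B) (y : ℕ → unitary A), ∀ n,
      (∀ b ∈ G n (x n), ‖twistHom (x (n + 1)) φ (twistHom (y n) ψ b) - b‖ ≤ (1 / 2) ^ n) ∧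
      (∀ a ∈ F n (y n),
        ‖twistHom (y (n + 1)) ψ (twistHom (x (n + 1)) φ a) - a‖ ≤ (1 / 2) ^ n) ∧
      (∀ g ∈ K n, ‖(twistCocycle β (x (n + 1)) v g : B) *
        twistHom (x (n + 1)) φ (twistCocycle α (y n) w g) - 1‖ ≤ (1 / 2) ^ n) ∧
      (∀ g ∈ K n, ‖(twistCocycle α (y (n + 1)) w g : A) *
        twistHom (y (n + 1)) ψ (twistCocycle β (x (n + 1)) v g) - 1‖ ≤ (1 / 2) ^ n) := by
  have hε (n : ℕ) : (0 : ℝ) < (1 / 2) ^ n := by positivity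
  choose X hX using fun (n : ℕ) (x : unitary B) (y : unitary A) =>
    exists_twist_approx_leftInverse hβ ψ hψw.1 φ hφv h2 y (hG n x) (hK n) (hε n)
  choose Y hY using fun (n : ℕ) (x : unitary B) (y : unitary A) =>
    exists_twist_approx_leftInverse hα φ hφv.1 ψ hψw h1 x (hF n y) (hK n) (hε n)
  let z : ℕ → unitary B × unitary A := fun n =>
    Nat.rec (1, 1) (fun n z => (X n z.1 z.2, Y n (X n z.1 z.2) z.2)) n
  refine ⟨fun n => (z n).1, fun n => (z n).2, fun n => ⟨?_, ?_, ?_, ?_⟩⟩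
  · exact (hX n (z n).1 (z n).2).1
  · exact (hY n (X n (z n).1 (z n).2) (z n).2).1
  · exact (hX n (z n).1 (z n).2).2
  · exact (hY n (X n (z n).1 (z n).2) (z n).2).2

/-- Two-sided intertwining for unital cocycle morphisms. -/
theorem exists_cocycle_conjugacy [Countable Γ]
    [TopologicalSpace.SeparableSpace A] [TopologicalSpace.SeparableSpace B]
    {α : Γ → A ≃⋆ₐ[ℂ] A} {β : Γ → B ≃⋆ₐ[ℂ] B}
    (hα : IsCStarAction α) (hβ : IsCStarAction β)
    {φ : A →⋆ₐ[ℂ] B} {v : Γ → unitary B} (hφv : IsCocyclePair α β φ v)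
    {ψ : B →⋆ₐ[ℂ] A} {w : Γ → unitary A} (hψw : IsCocyclePair β α ψ w)
    (h1 : CocycleApproxUnitaryEquiv α (fun a => ψ (φ a)) (id : A → A)
      (fun g => (w g : A) * ψ (v g)) (fun _ => (1 : A)))
    (h2 : CocycleApproxUnitaryEquiv β (fun b => φ (ψ b)) (id : B → B)
      (fun g => (v g : B) * φ (w g)) (fun _ => (1 : B))) :
    ∃ (Φ : A ≃⋆ₐ[ℂ] B) (V : Γ → unitary B),
      IsCocyclePair α β (⇑Φ) V ∧
      CocycleApproxUnitaryEquiv β (⇑Φ) (⇑φ) (fun g => (V g : B)) (fun g => (v g : B)) ∧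
      CocycleApproxUnitaryEquiv α (⇑Φ.symm) (⇑ψ)
        (fun g => star (Φ.symm (V g))) (fun g => (w g : A)) := by
  let a := TopologicalSpace.denseSeq A
  let b := TopologicalSpace.denseSeq B
  have ha : DenseRange a := TopologicalSpace.denseRange_denseSeq A
  have hb : DenseRange b := TopologicalSpace.denseRange_denseSeq B
  obtain ⟨γ, hγ⟩ := exists_surjective_nat Γ
  have hI (n : ℕ) : (Set.Iic n).Finite := Set.finite_Iic n
  obtain ⟨x, y, hxy⟩ := exists_twist_seq hα hβ hφv hψw h1 h2
    (F := fun n y => a '' Set.Iic n ∪ (fun i => twistHom y ψ (b i)) '' Set.Iic n)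
    (fun n _ => ((hI n).image _).union ((hI n).image _))
    (G := fun n x => b '' Set.Iic n ∪ (fun i => twistHom x φ (a i)) '' Set.Iic n ∪
      (fun i => (twistCocycle β x v (γ i) : B)) '' Set.Iic n)
    (fun n _ => (((hI n).image _).union ((hI n).image _)).union ((hI n).image _))
    (K := fun n => γ '' Set.Iic n) (fun n => (hI n).image _)
  set φ' := fun n => twistHom (x n) φ
  set ψ' := fun n => twistHom (y n) ψ
  set v' := fun n => twistCocycle β (x n) v
  set w' := fun n => twistCocycle α (y n) w
  have Gb {i n} (h : i ≤ n) : ‖φ' (n + 1) (ψ' n (b i)) - b i‖ ≤ (1 / 2) ^ n :=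
    (hxy n).1 _ (.inl (.inl ⟨i, h, rfl⟩))
  have Gφ {i n} (h : i ≤ n) : ‖φ' (n + 1) (ψ' n (φ' n (a i))) - φ' n (a i)‖ ≤ (1 / 2) ^ n :=
    (hxy n).1 _ (.inl (.inr ⟨i, h, rfl⟩))
  have Gv {i n} (h : i ≤ n) :
      ‖φ' (n + 1) (ψ' n (v' n (γ i))) - v' n (γ i)‖ ≤ (1 / 2) ^ n :=
    (hxy n).1 _ (.inr ⟨i, h, rfl⟩)
  have Fa {i n} (h : i ≤ n) : ‖ψ' (n + 1) (φ' (n + 1) (a i)) - a i‖ ≤ (1 / 2) ^ n :=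
    (hxy n).2.1 _ (.inl ⟨i, h, rfl⟩)
  have Fψ {i n} (h : i ≤ n) : ‖ψ' (n + 1) (φ' (n + 1) (ψ' n (b i))) - ψ' n (b i)‖ ≤ (1 / 2) ^ n :=
    (hxy n).2.1 _ (.inr ⟨i, h, rfl⟩)
  have Kv {i n} (h : i ≤ n) : ‖(v' (n + 1) (γ i) : B) * φ' (n + 1) (w' n (γ i)) - 1‖ ≤
      (1 / 2) ^ n := (hxy n).2.2.1 _ ⟨i, h, rfl⟩
  have Kw {i n} (h : i ≤ n) : ‖(w' (n + 1) (γ i) : A) * ψ' (n + 1) (v' (n + 1) (γ i)) - 1‖ ≤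
      (1 / 2) ^ n := (hxy n).2.2.2 _ ⟨i, h, rfl⟩
  have hφ'v (n) : IsCocyclePair α β (φ' n) (v' n) := hφv.twist hβ (x n)
  have cφ (i : ℕ) : CauchySeq fun n => φ' n (a i) := by
    refine (cauchySeq_shift 1).1 (cauchySeq_of_eventually_norm_sub_le (C := 2) ?_)
    filter_upwards [eventually_ge_atTop i] with n hn
    have h1 := (φ' (n + 1 + 1)).norm_map_sub_map_le (ψ' (n + 1) (φ' (n + 1) (a i))) (a i)
    have h2 := Fa hn
    have h3 := Gφ (n := n + 1) (hn.trans n.le_succ)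
    have h4 := norm_sub_le_norm_sub_add_norm_sub (φ' (n + 1 + 1) (a i))
      (φ' (n + 1 + 1) (ψ' (n + 1) (φ' (n + 1) (a i)))) (φ' (n + 1) (a i))
    rw [norm_sub_rev] at h1
    have h5 : (1 / 2 : ℝ) ^ (n + 1) ≤ (1 / 2) ^ n :=
      pow_le_pow_of_le_one (by norm_num) (by norm_num) n.le_succ
    linarith
  have cψ (i : ℕ) : CauchySeq fun n => ψ' n (b i) := by
    refine cauchySeq_of_eventually_norm_sub_le (C := 2) ?_
    filter_upwards [eventually_ge_atTop i] with n hn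
    have h1 := (ψ' (n + 1)).norm_map_sub_map_le (φ' (n + 1) (ψ' n (b i))) (b i)
    have h2 := Gb hn
    have h3 := Fψ hn
    have h4 := norm_sub_le_norm_sub_add_norm_sub (ψ' (n + 1) (b i))
      (ψ' (n + 1) (φ' (n + 1) (ψ' n (b i)))) (ψ' n (b i))
    rw [norm_sub_rev] at h1
    linarith
  have cv (g : Γ) : CauchySeq fun n => (v' n g : B) := by
    obtain ⟨i, rfl⟩ := hγ g
    refine (cauchySeq_shift 1).1 (cauchySeq_of_eventually_norm_sub_le (C := 3) ?_)
    filter_upwards [eventually_ge_atTop i] with n hn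
    have h1 := norm_sub_le_of_unitary (v' (n + 1 + 1) (γ i)).2
      (Unitary.map_mem (φ' (n + 1 + 1)) (Unitary.map_mem (ψ' (n + 1)) (v' (n + 1) (γ i)).2))
      (q := φ' (n + 1 + 1) (w' (n + 1) (γ i)))
    have h2 := (φ' (n + 1 + 1)).norm_map_sub_map_le (w' (n + 1) (γ i) * ψ' (n + 1) (v' (n + 1) (γ i))) 1
    rw [map_mul, map_one] at h2
    have h3 := Kw hn
    have h4 := Kv (n := n + 1) (hn.trans n.le_succ)
    have h5 := Gv (n := n + 1) (hn.trans n.le_succ)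
    have h6 := norm_sub_le_norm_sub_add_norm_sub (v' (n + 1 + 1) (γ i) : B)
      (φ' (n + 1 + 1) (ψ' (n + 1) (v' (n + 1) (γ i)))) (v' (n + 1) (γ i))
    have h7 : (1 / 2 : ℝ) ^ (n + 1) ≤ (1 / 2) ^ n :=
      pow_le_pow_of_le_one (by norm_num) (by norm_num) n.le_succ
    linarith
  obtain ⟨Φ, hΦ⟩ := StarAlgHom.exists_tendsto_of_cauchySeq ha cφ
  obtain ⟨Ψ, hΨ⟩ := StarAlgHom.exists_tendsto_of_cauchySeq hb cψ
  choose V hV using fun g => cauchySeq_tendsto_of_complete (cv g)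
  have hVu (g : Γ) : V g ∈ unitary B :=
    isClosed_unitary.mem_of_tendsto (hV g) (Eventually.of_forall fun n => (v' n g).2)
  have hΨΦ : Ψ.comp Φ = StarAlgHom.id ℂ A := by
    refine StarAlgHom.comp_eq_id_of_tendsto (fun c => (hΦ c).comp (tendsto_add_atTop_nat 1))
      (fun c => (hΨ c).comp (tendsto_add_atTop_nat 1)) ha fun i => ?_
    refine tendsto_of_eventually_norm_sub_le ?_
    filter_upwards [eventually_ge_atTop i] with n hn using Fa hn
  have hΦΨ : Φ.comp Ψ = StarAlgHom.id ℂ B := by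
    refine StarAlgHom.comp_eq_id_of_tendsto hΨ
      (fun c => (hΦ c).comp (tendsto_add_atTop_nat 1)) hb fun i => ?_
    refine tendsto_of_eventually_norm_sub_le ?_
    filter_upwards [eventually_ge_atTop i] with n hn using Gb hn
  have hW (g : Γ) : Tendsto (fun n => (w' n g : A)) atTop (𝓝 (star (Ψ (V g)))) := by
    refine (tendsto_add_atTop_iff_nat 1).1 ?_
    have hlim : Tendsto (fun n => (w' (n + 1) g : A) * ψ' (n + 1) (v' (n + 1) g)) atTop (𝓝 1) := by
      obtain ⟨i, rfl⟩ := hγ g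
      refine tendsto_of_eventually_norm_sub_le ?_
      filter_upwards [eventually_ge_atTop i] with n hn using Kw hn
    have hψV := (StarAlgHom.tendsto_apply hΨ (hV g)).comp (tendsto_add_atTop_nat 1)
    rw [← one_mul (star (Ψ (V g)))]
    refine (hlim.mul hψV.star).congr fun n => ?_
    have := Unitary.mul_star_self_of_mem (Unitary.map_mem (ψ' (n + 1)) (v' (n + 1) g).2)
    rw [Function.comp_apply, mul_assoc, this, mul_one]
  exact ⟨.ofStarAlgHom Φ Ψ hΨΦ hΦΨ, fun g => ⟨V g, hVu g⟩, .of_tendsto hφ'v hΦ hV,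
    .of_tendsto_twist hΦ hV, .of_tendsto_twist hΨ hW⟩

end Intertwining

/-- Two-sided Elliott intertwining for cocycle morphisms of group actions:
if `(ψ, w) ∘ (φ, v)` and `(φ, v) ∘ (ψ, w)` are approximately unitarily equivalent to the
respective identity cocycle morphisms, then there is a cocycle conjugacy `(Φ, V)` approximately
unitarily equivalent to `(φ, v)` whose inverse is approximately unitarily equivalent
to `(ψ, w)`. -/
theorem stmt0 {Γ A B : Type*} [Group Γ] [Countable Γ]
    [CStarAlgebra A] [CStarAlgebra B]
    [TopologicalSpace.SeparableSpace A] [TopologicalSpace.SeparableSpace B]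
    (α : Γ → A ≃⋆ₐ[ℂ] A) (β : Γ → B ≃⋆ₐ[ℂ] B)
    (hα : IsCStarAction α) (hβ : IsCStarAction β)
    (φ : A →⋆ₙₐ[ℂ] B) (v : Γ → unitary B) (hφv : IsCocyclePair α β (⇑φ) v)
    (ψ : B →⋆ₙₐ[ℂ] A) (w : Γ → unitary A) (hψw : IsCocyclePair β α (⇑ψ) w)
    (h1 : CocycleApproxUnitaryEquiv α (fun a => ψ (φ a)) (id : A → A)
      (fun g => (w g : A) * ψ (v g)) (fun _ => (1 : A)))
    (h2 : CocycleApproxUnitaryEquiv β (fun b => φ (ψ b)) (id : B → B)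
      (fun g => (v g : B) * φ (w g)) (fun _ => (1 : B))) :
    ∃ (Φ : A ≃⋆ₐ[ℂ] B) (V : Γ → unitary B),
      IsCocyclePair α β (⇑Φ) V ∧
      CocycleApproxUnitaryEquiv β (⇑Φ) (⇑φ) (fun g => (V g : B)) (fun g => (v g : B)) ∧
      CocycleApproxUnitaryEquiv α (⇑Φ.symm) (⇑ψ)
        (fun g => star (Φ.symm (V g))) (fun g => (w g : A)) := by
  have hψ := h1.map_one hα hφv.1 hψw.1
  have hφ := h2.map_one hβ hψw.1 hφv.1
  exact exists_cocycle_conjugacy hα hβ (φ := φ.ofMapOne hφ) hφv (ψ := ψ.ofMapOne hψ) hψw h1 h2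
end

section
/- Let A and B be separable C*-algebras, and let φ: A → B and ψ: B → A be extendible *-homomorphisms such that ψ ∘ φ is approximately unitarily equivalent to the identity map of A and φ ∘ ψ is approximately unitarily equivalent to the identity map of B. Then there exists a *-isomorphism Φ: A → B such that Φ is approximately unitarily equivalent to φ and the inverse isomorphism Φ⁻¹: B → A is approximately unitarily equivalent to ψ. -/
open Filter Topology MultiplierAlgebra

/-- An increasing approximate unit for a (possibly non-unital) C⋆-algebra `A`:
an increasing net of positive contractions converging to the identity multiplier
(i.e. `e i * a → a` and `a * e i → a` for every `a`). -/
def IsIncreasingApproximateUnit {A : Type*} [NonUnitalCStarAlgebra A] [PartialOrder A]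
    {ι : Type*} [Preorder ι] (e : ι → A) : Prop :=
  Monotone e ∧ (∀ i, 0 ≤ e i) ∧ (∀ i, ‖e i‖ ≤ 1) ∧
    ∀ a : A, Tendsto (fun i => e i * a) atTop (𝓝 a) ∧ Tendsto (fun i => a * e i) atTop (𝓝 a)

/-- A ⋆-homomorphism `φ : A → B` is extendible if for every increasing approximate unit
`(e i)` of `A`, the net `(φ (e i))` converges strictly in the multiplier algebra `𝓜(ℂ, B)`. -/
def Extendible {A B : Type*} [NonUnitalCStarAlgebra A] [PartialOrder A]
    [NonUnitalCStarAlgebra B] (φ : A →⋆ₙₐ[ℂ] B) : Prop :=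
  ∀ (ι : Type*) [Preorder ι] [IsDirected ι (· ≤ ·)] [Nonempty ι] (e : ι → A),
    IsIncreasingApproximateUnit e →
      ∃ m : 𝓜(ℂ, B), ∀ b : B,
        Tendsto (fun i => ((φ (e i) : 𝓜(ℂ, B)) * (b : 𝓜(ℂ, B)))) atTop (𝓝 (m * (b : 𝓜(ℂ, B)))) ∧
        Tendsto (fun i => ((b : 𝓜(ℂ, B)) * (φ (e i) : 𝓜(ℂ, B)))) atTop (𝓝 ((b : 𝓜(ℂ, B)) * m))

/-- Two maps `A → B` are approximately unitarily equivalent if there is a sequence of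
unitaries in the multiplier algebra `𝓜(ℂ, B)` conjugating one to the other pointwise in norm. -/
def ApproxUnitaryEquiv {A B : Type*} [NonUnitalCStarAlgebra A] [NonUnitalCStarAlgebra B]
    (φ ψ : A → B) : Prop :=
  ∃ u : ℕ → unitary 𝓜(ℂ, B), ∀ a : A,
    Tendsto
      (fun n => ‖(u n : 𝓜(ℂ, B)) * (φ a : 𝓜(ℂ, B)) * star (u n : 𝓜(ℂ, B)) - (ψ a : 𝓜(ℂ, B))‖)
      atTop (𝓝 (0 : ℝ))

section MetricIntertwining

variable {G H X Y : Type*} [Group G] [Group H] [MetricSpace X] [MetricSpace Y]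
  [MulAction G X] [IsIsometricSMul G X] [MulAction H Y]

/-- Two maps into a metric space with a `G`-action are locally equivalent if on each finite set
one is approximated by translates of the other. -/
def LocallyEquiv (G : Type*) {Z W : Type*} [SMul G W] [MetricSpace W] (f k : Z → W) : Prop :=
  ∀ F : Finset Z, ∀ ε > 0, ∃ g : G, ∀ z ∈ F, dist (g • f z) (k z) < ε

lemma LocallyEquiv.isometry {φ : X → Y} {ψ : Y → X} (hφ : LipschitzWith 1 φ)
    (hψ : LipschitzWith 1 ψ) (h : LocallyEquiv G (ψ ∘ φ) id) : Isometry φ := by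
  classical
  refine Isometry.of_dist_eq fun x y => le_antisymm (by simpa using hφ.dist_le_mul x y) ?_
  refine le_of_forall_pos_le_add fun ε hε => ?_
  obtain ⟨g, hg⟩ := h {x, y} (ε / 2) (half_pos hε)
  have hx := hg x (by simp)
  have hy := hg y (by simp)
  have hψ' := hψ.dist_le_mul (φ x) (φ y)
  have htri := dist_triangle4 x (g • ψ (φ x)) (g • ψ (φ y)) y
  simp only [Function.comp_apply, id, NNReal.coe_one, one_mul, dist_smul] at hx hy hψ' htri
  rw [dist_comm x (g • _)] at htri
  linarith

lemma exists_intertwining_step [IsIsometricSMul H Y] {φ : X → Y} {ψ : Y → X} (hφ : LipschitzWith 1 φ)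
    (hφG : ∀ g : G, ∃ h : H, ∀ x, φ (g • x) = h • φ x)
    (hψH : ∀ h : H, ∃ g : G, ∀ y, ψ (h • y) = g • ψ y)
    (hψφ : LocallyEquiv G (ψ ∘ φ) id) (hφψ : LocallyEquiv H (φ ∘ ψ) id)
    (h : H) (F : Finset X) (E : Finset Y) {ε : ℝ} (hε : 0 < ε) :
    ∃ (h' : H) (τ : Y → X), (∀ x ∈ F, dist (h' • φ x) (h • φ x) < ε) ∧
      ∀ y ∈ E, dist (h' • φ (τ y)) y < ε := by
  classical
  obtain ⟨k, hk⟩ := hφψ (F.image (fun x => h • φ x) ∪ E) (ε / 2) (half_pos hε)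
  obtain ⟨g, hg⟩ := hψH h
  obtain ⟨g₂, hg₂⟩ := hψφ F (ε / 2) (half_pos hε)
  obtain ⟨h₃, hh₃⟩ := hφG (g * g₂⁻¹)
  refine ⟨k * h₃, fun y => g₂ • g⁻¹ • ψ y, fun x hx => ?_, fun y hy => ?_⟩
  · have e1 := hk (h • φ x) (Finset.mem_union_left _ (Finset.mem_image_of_mem _ hx))
    have e2 := hg₂ x hx
    have e3 : dist ((k * h₃) • φ x) (k • φ (ψ (h • φ x))) < ε / 2 := by
      rw [mul_smul, dist_smul, ← hh₃, hg]
      refine lt_of_le_of_lt (by simpa using hφ.dist_le_mul _ _) ?_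
      rw [mul_smul, dist_smul, ← dist_smul g₂, smul_inv_smul, dist_comm]
      exact e2
    have := dist_triangle ((k * h₃) • φ x) (k • φ (ψ (h • φ x))) (h • φ x)
    simp only [Function.comp_apply, id] at e1
    linarith
  · have e1 := hk y (Finset.mem_union_right _ hy)
    have : (k * h₃) • φ (g₂ • g⁻¹ • ψ y) = k • φ (ψ y) := by
      rw [mul_smul, ← hh₃, mul_smul, inv_smul_smul, smul_inv_smul]
    rw [this]
    exact e1.trans (half_lt_self hε)

/-- Approximate intertwining for isometric group actions. -/
theorem exists_surjective_limit_of_locallyEquiv [IsIsometricSMul H Y]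
    [CompleteSpace X] [CompleteSpace Y]
    [TopologicalSpace.SeparableSpace X] [TopologicalSpace.SeparableSpace Y]
    [Nonempty X] [Nonempty Y] {φ : X → Y} {ψ : Y → X}
    (hφ : LipschitzWith 1 φ) (hψ : LipschitzWith 1 ψ)
    (hφG : ∀ g : G, ∃ h : H, ∀ x, φ (g • x) = h • φ x)
    (hψH : ∀ h : H, ∃ g : G, ∀ y, ψ (h • y) = g • ψ y)
    (hψφ : LocallyEquiv G (ψ ∘ φ) id) (hφψ : LocallyEquiv H (φ ∘ ψ) id) :
    ∃ (h : ℕ → H) (Φ : X → Y), (∀ x, Tendsto (fun n => h n • φ x) atTop (𝓝 (Φ x))) ∧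
      Isometry Φ ∧ Function.Surjective Φ := by
  classical
  set x := TopologicalSpace.denseSeq X
  set y := TopologicalSpace.denseSeq Y
  have hiso : Isometry φ := hψφ.isometry hφ hψ
  have step : ∀ (n : ℕ) (s : H × Finset X), ∃ s' : H × Finset X, s.2 ⊆ s'.2 ∧ x n ∈ s'.2 ∧
      (∀ a ∈ s.2, dist (s.1 • φ a) (s'.1 • φ a) < (1 / 2) ^ n) ∧
      ∀ k ≤ n, ∃ z ∈ s'.2, dist (s'.1 • φ z) (y k) < (1 / 2) ^ n := by
    intro n s
    obtain ⟨h', τ, h1, h2⟩ := exists_intertwining_step hφ hφG hψH hψφ hφψ s.1 s.2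
      ((Finset.range (n + 1)).image y) (ε := (1 / 2) ^ n) (by positivity)
    refine ⟨(h', s.2 ∪ ({x n} ∪ ((Finset.range (n + 1)).image y).image τ)),
      Finset.subset_union_left, by simp, fun a ha => ?_, fun k hk => ?_⟩
    · rw [dist_comm]
      exact h1 a ha
    · have hy : y k ∈ (Finset.range (n + 1)).image y :=
        Finset.mem_image_of_mem _ (Finset.mem_range.2 (by omega))
      exact ⟨τ (y k), Finset.mem_union_right _ (Finset.mem_union_right _
        (Finset.mem_image_of_mem _ hy)), h2 _ hy⟩
  choose next hsub hmem hdist happ using step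
  let S : ℕ → H × Finset X := fun n => Nat.rec (1, ∅) next n
  have hmono : Monotone fun n => (S n).2 := monotone_nat_of_le_succ fun n => hsub n (S n)
  have hgeo : ∀ N, ∀ a ∈ (S N).2, ∀ m,
      dist ((S (m + N)).1 • φ a) ((S (m + 1 + N)).1 • φ a) ≤ 2 * (1 / 2) ^ N / 2 / 2 ^ m := by
    intro N a ha m
    have := hdist (m + N) (S (m + N)) a (hmono (Nat.le_add_left N m) ha)
    rw [show m + 1 + N = m + N + 1 by ring]
    refine this.le.trans (le_of_eq ?_)
    rw [pow_add, one_div_pow, one_div_pow]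
    ring
  have hcauchy : ∀ a, CauchySeq fun n => (S n).1 • φ a := by
    intro a
    refine Metric.cauchySeq_iff.2 fun ε hε => ?_
    obtain ⟨k, hk⟩ := (TopologicalSpace.denseRange_denseSeq X).exists_dist_lt a
      (show 0 < ε / 3 by positivity)
    have hc : CauchySeq fun n => (S n).1 • φ (x k) :=
      (cauchySeq_shift (k + 1)).1 (cauchySeq_of_le_geometric_two
        (hgeo (k + 1) (x k) (hmem k (S k))))
    obtain ⟨N, hN⟩ := Metric.cauchySeq_iff.1 hc (ε / 3) (by positivity)
    refine ⟨N, fun m hm n hn => ?_⟩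
    have e1 := hN m hm n hn
    have e2 := dist_triangle4 ((S m).1 • φ a) ((S m).1 • φ (x k)) ((S n).1 • φ (x k))
      ((S n).1 • φ a)
    rw [dist_smul, dist_smul, hiso.dist_eq, hiso.dist_eq, dist_comm (x k) a] at e2
    linarith
  choose Φ hΦ using fun a => cauchySeq_tendsto_of_complete (hcauchy a)
  have hΦiso : Isometry Φ := Isometry.of_dist_eq fun a b =>
    tendsto_nhds_unique ((hΦ a).dist (hΦ b)) (by simp [dist_smul, hiso.dist_eq])
  refine ⟨fun n => (S n).1, Φ, hΦ, hΦiso, ?_⟩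
  have hy : ∀ k, y k ∈ Set.range Φ := by
    intro k
    rw [← hΦiso.isClosedEmbedding.isClosed_range.closure_eq]
    refine Metric.mem_closure_range_iff.2 fun ε hε => ?_
    obtain ⟨N, hN⟩ := exists_pow_lt_of_lt_one (show 0 < ε / 2 by positivity)
      (show (1 / 2 : ℝ) < 1 by norm_num)
    have hM : (1 / 2 : ℝ) ^ (max N k) < ε / 2 :=
      (pow_le_pow_of_le_one (by norm_num) (by norm_num) (le_max_left N k)).trans_lt hN
    obtain ⟨z, hz, hzk⟩ := happ (max N k) (S (max N k)) k (le_max_right N k)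
    refine ⟨z, ?_⟩
    have e1 := dist_le_of_le_geometric_two_of_tendsto₀
      (f := fun m => (S (m + (max N k + 1))).1 • φ z) (hgeo (max N k + 1) z hz)
      ((tendsto_add_atTop_iff_nat (f := fun n => (S n).1 • φ z) (max N k + 1)).2 (hΦ z))
    have e2 := dist_triangle (y k) ((S (max N k + 1)).1 • φ z) (Φ z)
    rw [dist_comm (y k) (_ • _)] at e2
    rw [zero_add, pow_succ] at e1
    change dist ((S (max N k + 1)).1 • φ z) (y k) < _ at hzk
    linarith
  rw [← Set.range_eq_univ, ← hΦiso.isClosedEmbedding.isClosed_range.closure_eq]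
  exact ((TopologicalSpace.denseRange_denseSeq Y).mono (Set.range_subset_iff.2 hy)).closure_eq

/-- The inverse of a limit of translates of `φ` is locally equivalent to `ψ`. -/
lemma LocallyEquiv.of_inverse {φ : X → Y} {ψ : Y → X} (hψ : LipschitzWith 1 ψ)
    (hψH : ∀ h : H, ∃ g : G, ∀ y, ψ (h • y) = g • ψ y)
    (hψφ : LocallyEquiv G (ψ ∘ φ) id) {h : ℕ → H} {Φ : X → Y} {Ψ : Y → X}
    (hΦ : ∀ x, Tendsto (fun n => h n • φ x) atTop (𝓝 (Φ x)))
    (hΦΨ : Function.RightInverse Ψ Φ) : LocallyEquiv G Ψ ψ := by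
  classical
  intro F ε hε
  obtain ⟨g₂, hg₂⟩ := hψφ (F.image Ψ) (ε / 2) (half_pos hε)
  have hev : ∀ᶠ n in atTop, ∀ y ∈ F, dist (h n • φ (Ψ y)) y < ε / 2 := by
    refine F.eventually_all.2 fun y _ => ?_
    have := hΦ (Ψ y)
    rw [hΦΨ y] at this
    exact (Metric.tendsto_nhds.1 this) _ (half_pos hε)
  obtain ⟨n, hn⟩ := hev.exists
  obtain ⟨g, hg⟩ := hψH (h n)
  refine ⟨g * g₂⁻¹, fun y hy => ?_⟩
  have e1 := hn y hy
  have e2 := hg₂ (Ψ y) (Finset.mem_image_of_mem _ hy)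
  have e3 := hψ.dist_le_mul (h n • φ (Ψ y)) y
  have e4 := dist_triangle ((g * g₂⁻¹) • Ψ y) (ψ (h n • φ (Ψ y))) (ψ y)
  have e5 : dist ((g * g₂⁻¹) • Ψ y) (ψ (h n • φ (Ψ y))) = dist (g₂ • ψ (φ (Ψ y))) (Ψ y) := by
    rw [hg, mul_smul, dist_smul, ← dist_smul g₂, smul_inv_smul, dist_comm]
  simp only [Function.comp_apply, id, NNReal.coe_one, one_mul] at e2 e3
  linarith

lemma LocallyEquiv.exists_seq_tendsto {Z : Type*} [MetricSpace Z]
    [TopologicalSpace.SeparableSpace Z] [Nonempty Z] {f k : Z → X} (hf : LipschitzWith 1 f)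
    (hk : LipschitzWith 1 k) (h : LocallyEquiv G f k) :
    ∃ g : ℕ → G, ∀ z, Tendsto (fun n => g n • f z) atTop (𝓝 (k z)) := by
  classical
  set x := TopologicalSpace.denseSeq Z
  choose g hg using fun n : ℕ => h ((Finset.range (n + 1)).image x) ((1 / 2) ^ n) (by positivity)
  refine ⟨g, fun z => Metric.tendsto_atTop.2 fun ε hε => ?_⟩
  obtain ⟨j, hj⟩ := (TopologicalSpace.denseRange_denseSeq Z).exists_dist_lt z
    (show 0 < ε / 3 by positivity)
  obtain ⟨N, hN⟩ := exists_pow_lt_of_lt_one (show 0 < ε / 3 by positivity)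
    (show (1 / 2 : ℝ) < 1 by norm_num)
  refine ⟨max N j, fun n hn => ?_⟩
  have e0 : (1 / 2 : ℝ) ^ n < ε / 3 :=
    (pow_le_pow_of_le_one (by norm_num) (by norm_num) ((le_max_left N j).trans hn)).trans_lt hN
  have e1 := hg n (x j) (Finset.mem_image_of_mem _ (Finset.mem_range.2
    (Nat.lt_succ_of_le ((le_max_right N j).trans hn))))
  have e2 := dist_triangle4 (g n • f z) (g n • f (x j)) (k (x j)) (k z)
  have e3 := hf.dist_le_mul z (x j)
  have e4 := hk.dist_le_mul (x j) z
  rw [dist_smul] at e2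
  simp only [NNReal.coe_one, one_mul] at e3 e4
  rw [dist_comm (x j) z] at e4
  linarith

lemma LocallyEquiv.of_tendsto {G Z W : Type*} [SMul G W] [MetricSpace W] {f k : Z → W} {g : ℕ → G}
    (h : ∀ z, Tendsto (fun n => g n • f z) atTop (𝓝 (k z))) : LocallyEquiv G f k := by
  intro F ε hε
  obtain ⟨n, hn⟩ :=
    (F.eventually_all.2 fun z _ => (Metric.tendsto_nhds.1 (h z)) ε hε).exists
  exact ⟨g n, hn⟩

lemma LocallyEquiv.symm {Z : Type*} {f k : Z → X} (h : LocallyEquiv G f k) :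
    LocallyEquiv G k f := by
  intro F ε hε
  obtain ⟨g, hg⟩ := h F ε hε
  refine ⟨g⁻¹, fun z hz => ?_⟩
  rw [← dist_smul g, smul_inv_smul, dist_comm]
  exact hg z hz

end MetricIntertwining

section Multiplier

variable {A : Type*} [NonUnitalCStarAlgebra A]

namespace DoubleCentralizer

lemma ext_fst {S T : 𝓜(ℂ, A)} (h : ∀ a, S.fst a = T.fst a) : S = T := by
  rw [← sub_eq_zero, ← norm_eq_zero, ← norm_fst, norm_eq_zero]
  ext a
  simp [h]

lemma ext_snd {S T : 𝓜(ℂ, A)} (h : ∀ a, S.snd a = T.snd a) : S = T := by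
  rw [← sub_eq_zero, ← norm_eq_zero, ← norm_snd, norm_eq_zero]
  ext a
  simp [h]

lemma norm_coe (a : A) : ‖(a : 𝓜(ℂ, A))‖ = ‖a‖ := by
  rw [← norm_fst, coe_fst, ContinuousLinearMap.opNorm_mul_apply]

lemma coe_map_sub (a b : A) : ((a - b : A) : 𝓜(ℂ, A)) = a - b :=
  map_sub (coeHom (𝕜 := ℂ) (A := A)) a b

lemma coe_map_mul (a b : A) : ((a * b : A) : 𝓜(ℂ, A)) = a * b :=
  map_mul (coeHom (𝕜 := ℂ) (A := A)) a b

lemma coe_map_star (a : A) : ((star a : A) : 𝓜(ℂ, A)) = star (a : 𝓜(ℂ, A)) :=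
  map_star (coeHom (𝕜 := ℂ) (A := A)) a

lemma isometry_coe : Isometry (fun a : A => (a : 𝓜(ℂ, A))) :=
  Isometry.of_dist_eq fun a b => by rw [dist_eq_norm, dist_eq_norm, ← coe_map_sub, norm_coe]

lemma coe_injective : Function.Injective (fun a : A => (a : 𝓜(ℂ, A))) :=
  isometry_coe.injective

lemma mul_coe (S : 𝓜(ℂ, A)) (a : A) : S * (a : 𝓜(ℂ, A)) = (S.fst a : A) :=
  ext_snd fun x => by simpa using! S.central x a

lemma coe_mul (S : 𝓜(ℂ, A)) (a : A) : (a : 𝓜(ℂ, A)) * S = (S.snd a : A) :=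
  ext_fst fun x => by simpa using! (S.central a x).symm

lemma fst_mul (S : 𝓜(ℂ, A)) (a b : A) : S.fst (a * b) = S.fst a * b :=
  coe_injective (by
    change ((S.fst (a * b) : A) : 𝓜(ℂ, A)) = ((S.fst a * b : A) : 𝓜(ℂ, A))
    rw [← mul_coe, coe_map_mul, coe_map_mul, ← mul_coe, mul_assoc])

lemma snd_mul (S : 𝓜(ℂ, A)) (a b : A) : S.snd (a * b) = a * S.snd b :=
  coe_injective (by
    change ((S.snd (a * b) : A) : 𝓜(ℂ, A)) = ((a * S.snd b : A) : 𝓜(ℂ, A))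
    rw [← coe_mul, coe_map_mul, coe_map_mul, ← coe_mul, mul_assoc])

/-- The unitary group of the multiplier algebra acts on the algebra by conjugation. -/
noncomputable instance instSMulUnitary : SMul (unitary 𝓜(ℂ, A)) A where
  smul u a := (star (u : 𝓜(ℂ, A))).snd ((u : 𝓜(ℂ, A)).fst a)

lemma unitary_smul_def (u : unitary 𝓜(ℂ, A)) (a : A) :
    u • a = (star (u : 𝓜(ℂ, A))).snd ((u : 𝓜(ℂ, A)).fst a) := rfl

lemma coe_unitary_smul (u : unitary 𝓜(ℂ, A)) (a : A) :
    ((u • a : A) : 𝓜(ℂ, A)) = u * (a : 𝓜(ℂ, A)) * star (u : 𝓜(ℂ, A)) := by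
  rw [unitary_smul_def, ← coe_mul, ← mul_coe]

noncomputable instance instMulActionUnitary : MulAction (unitary 𝓜(ℂ, A)) A where
  one_smul a := coe_injective (by simp [coe_unitary_smul])
  mul_smul u v a := coe_injective (by simp [coe_unitary_smul, mul_assoc])

lemma unitary_smul_add (u : unitary 𝓜(ℂ, A)) (a b : A) : u • (a + b) = u • a + u • b := by
  simp [unitary_smul_def]

lemma unitary_smul_smul (u : unitary 𝓜(ℂ, A)) (c : ℂ) (a : A) : u • c • a = c • u • a := by
  simp [unitary_smul_def]

lemma unitary_smul_mul (u : unitary 𝓜(ℂ, A)) (a b : A) : u • (a * b) = (u • a) * (u • b) := by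
  apply coe_injective
  change ((u • (a * b) : A) : 𝓜(ℂ, A)) = (((u • a) * (u • b) : A) : 𝓜(ℂ, A))
  rw [coe_map_mul, coe_unitary_smul, coe_unitary_smul, coe_unitary_smul, coe_map_mul]
  simp only [mul_assoc]
  rw [← mul_assoc (star (u : 𝓜(ℂ, A))) u, Unitary.coe_star_mul_self, one_mul]

lemma unitary_smul_star (u : unitary 𝓜(ℂ, A)) (a : A) : u • star a = star (u • a) := by
  apply coe_injective
  change ((u • star a : A) : 𝓜(ℂ, A)) = ((star (u • a) : A) : 𝓜(ℂ, A))
  rw [coe_map_star, coe_unitary_smul, coe_unitary_smul, coe_map_star]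
  simp [mul_assoc]

instance instIsIsometricSMulUnitary : IsIsometricSMul (unitary 𝓜(ℂ, A)) A where
  isometry_smul u := Isometry.of_dist_eq fun a b => by
    rw [← isometry_coe.dist_eq (u • a), ← isometry_coe.dist_eq a]
    simp only [coe_unitary_smul, dist_eq_norm]
    rw [← sub_mul, ← mul_sub, ← Unitary.coe_star, CStarRing.norm_mul_coe_unitary,
      CStarRing.norm_coe_unitary_mul]

end DoubleCentralizer

open DoubleCentralizer

lemma approxUnitaryEquiv_iff {A B : Type*} [NonUnitalCStarAlgebra A] [NonUnitalCStarAlgebra B]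
    {f k : A → B} : ApproxUnitaryEquiv f k ↔
      ∃ u : ℕ → unitary 𝓜(ℂ, B), ∀ a, Tendsto (fun n => u n • f a) atTop (𝓝 (k a)) := by
  refine exists_congr fun u => forall_congr' fun a => ?_
  simp only [← coe_unitary_smul, ← coe_map_sub, norm_coe]
  exact tendsto_iff_norm_sub_tendsto_zero.symm

lemma approxUnitaryEquiv_iff_locallyEquiv {A B : Type*} [NonUnitalCStarAlgebra A]
    [NonUnitalCStarAlgebra B] [TopologicalSpace.SeparableSpace A] {f k : A → B}
    (hf : LipschitzWith 1 f) (hk : LipschitzWith 1 k) :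
    ApproxUnitaryEquiv f k ↔ LocallyEquiv (unitary 𝓜(ℂ, B)) f k := by
  rw [approxUnitaryEquiv_iff]
  exact ⟨fun ⟨_, hu⟩ => .of_tendsto hu, fun h => h.exists_seq_tendsto hf hk⟩

/-- A separable C⋆-algebra has an increasing approximate unit indexed by `ℕ`. -/
lemma exists_isIncreasingApproximateUnit_nat (A : Type*) [NonUnitalCStarAlgebra A] [PartialOrder A]
    [StarOrderedRing A] [TopologicalSpace.SeparableSpace A] :
    ∃ e : ℕ → A, _root_.IsIncreasingApproximateUnit e := by
  set x := TopologicalSpace.denseSeq A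
  have hl := CStarAlgebra.increasingApproximateUnit A
  have hb := CStarAlgebra.hasBasis_approximateUnit A
  have step : ∀ (n : ℕ) (a : {a : A // 0 ≤ a ∧ ‖a‖ < 1}), ∃ b : {a : A // 0 ≤ a ∧ ‖a‖ < 1},
      a ≤ b ∧ ∀ k ≤ n, ∀ c, b.1 ≤ c → ‖c‖ ≤ 1 → dist (c * x k) (x k) < (1 / 2) ^ n := by
    intro n a
    have h1 : ∀ᶠ c in CStarAlgebra.approximateUnit A,
        a.1 ≤ c ∧ ∀ k ∈ Finset.range (n + 1), dist (c * x k) (x k) < (1 / 2) ^ n := by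
      have h2 : ∀ᶠ c in CStarAlgebra.approximateUnit A, a.1 ≤ c :=
        Filter.mem_of_superset (hb.mem_of_mem a.2) fun c hc => hc.1
      refine h2.and ((Finset.eventually_all _).2 fun k _ => ?_)
      exact Metric.tendsto_nhds.1 (hl.tendsto_mul_right (x k)) _ (by positivity)
    obtain ⟨b, hb', hbs⟩ := hb.eventually_iff.1 h1
    refine ⟨⟨b, hb'⟩, (hbs ⟨le_rfl, by simpa using hb'.2.le⟩).1, fun k hk c hc hc1 => ?_⟩
    exact (hbs ⟨hc, by simpa using hc1⟩).2 k (Finset.mem_range.2 (by omega))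
  choose next hle hnext using step
  let e : ℕ → {a : A // 0 ≤ a ∧ ‖a‖ < 1} := fun n => Nat.rec ⟨0, by simp⟩ next n
  have hmono : Monotone e := monotone_nat_of_le_succ fun n => hle n (e n)
  have hnorm : ∀ n, ‖(e n).1‖ ≤ 1 := fun n => (e n).2.2.le
  have hleft : ∀ a : A, Tendsto (fun n => (e n).1 * a) atTop (𝓝 a) := by
    intro a
    refine Metric.tendsto_atTop.2 fun ε hε => ?_
    obtain ⟨j, hj⟩ := (TopologicalSpace.denseRange_denseSeq A).exists_dist_lt a
      (show 0 < ε / 3 by positivity)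
    obtain ⟨N, hN⟩ := exists_pow_lt_of_lt_one (show 0 < ε / 3 by positivity)
      (show (1 / 2 : ℝ) < 1 by norm_num)
    refine ⟨max N j + 1, fun n hn => ?_⟩
    have e0 : (1 / 2 : ℝ) ^ (max N j) < ε / 3 :=
      (pow_le_pow_of_le_one (by norm_num) (by norm_num) (le_max_left N j)).trans_lt hN
    have e1 := hnext (max N j) (e (max N j)) j (le_max_right N j) (e n).1 (hmono hn) (hnorm n)
    have e2 := dist_triangle4 ((e n).1 * a) ((e n).1 * x j) (x j) a
    have e3 : dist ((e n).1 * a) ((e n).1 * x j) ≤ dist a (x j) := by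
      rw [dist_eq_norm, dist_eq_norm, ← mul_sub]
      exact (norm_mul_le _ _).trans (mul_le_of_le_one_left (norm_nonneg _) (hnorm n))
    rw [dist_comm (x j) a] at e2
    linarith
  refine ⟨fun n => (e n).1, fun m n h => hmono h, fun n => (e n).2.1, hnorm, fun a => ⟨hleft a, ?_⟩⟩
  have := (hleft (star a)).star
  simpa [(e _).2.1.isSelfAdjoint.star_eq] using this

variable {B : Type*} [NonUnitalCStarAlgebra B]

/-- The strict limit of the image of a sequential approximate unit. -/
lemma Extendible.exists_strict_limit [PartialOrder A] {φ : A →⋆ₙₐ[ℂ] B}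
    (hφ : Extendible φ) {e : ℕ → A} (he : _root_.IsIncreasingApproximateUnit e) :
    ∃ p : 𝓜(ℂ, B), ∀ b : B, Tendsto (fun n => φ (e n) * b) atTop (𝓝 (p.fst b)) ∧
      Tendsto (fun n => b * φ (e n)) atTop (𝓝 (p.snd b)) := by
  have hdown : Tendsto (ULift.down : ULift ℕ → ℕ) atTop atTop :=
    tendsto_atTop.2 fun n => eventually_atTop.2 ⟨ULift.up n, fun _ h => h⟩
  have hup : Tendsto (ULift.up : ℕ → ULift ℕ) atTop atTop :=
    tendsto_atTop.2 fun n => eventually_atTop.2 ⟨n.down, fun _ h => h⟩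
  obtain ⟨p, hp⟩ := hφ (ULift ℕ) (fun i => e i.down)
    ⟨fun i j h => he.1 h, fun i => he.2.1 _, fun i => he.2.2.1 _,
      fun a => ⟨((he.2.2.2 a).1).comp hdown, ((he.2.2.2 a).2).comp hdown⟩⟩
  refine ⟨p, fun b => ?_⟩
  obtain ⟨h1, h2⟩ := hp b
  rw [mul_coe] at h1
  rw [coe_mul] at h2
  simp only [← coe_map_mul] at h1 h2
  exact ⟨isometry_coe.isUniformInducing.isInducing.tendsto_nhds_iff.2 (h1.comp hup),
    isometry_coe.isUniformInducing.isInducing.tendsto_nhds_iff.2 (h2.comp hup)⟩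

lemma lipschitzWith_one_starAlgHom (φ : A →⋆ₙₐ[ℂ] B) : LipschitzWith 1 φ :=
  LipschitzWith.of_dist_le_mul fun a b => by
    rw [dist_eq_norm, dist_eq_norm, ← map_sub, NNReal.coe_one, one_mul]
    exact NonUnitalStarAlgHom.norm_apply_le φ _

lemma norm_map_fst_unitary_mul (φ : A →⋆ₙₐ[ℂ] B) (v : unitary 𝓜(ℂ, A)) (a : A) (b : B) :
    ‖φ ((v : 𝓜(ℂ, A)).fst a) * b‖ = ‖φ a * b‖ := by
  have h : star ((v : 𝓜(ℂ, A)).fst a) * (v : 𝓜(ℂ, A)).fst a = star a * a := by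
    apply coe_injective
    simp only [coe_map_mul, coe_map_star, ← mul_coe, star_mul]
    rw [mul_assoc, ← mul_assoc (star (v : 𝓜(ℂ, A))), Unitary.coe_star_mul_self, one_mul]
  rw [← mul_self_inj (norm_nonneg _) (norm_nonneg _), ← CStarRing.norm_star_mul_self,
    ← CStarRing.norm_star_mul_self]
  simp only [star_mul, ← map_star, mul_assoc]
  rw [← mul_assoc (φ _), ← map_mul, h, map_mul, mul_assoc]

lemma norm_mul_map_snd_unitary (φ : A →⋆ₙₐ[ℂ] B) (v : unitary 𝓜(ℂ, A)) (a : A) (b : B) :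
    ‖b * φ ((v : 𝓜(ℂ, A)).snd a)‖ = ‖b * φ a‖ := by
  have := norm_map_fst_unitary_mul φ (star v) (star a) (star b)
  rw [Unitary.coe_star, star_fst, star_star, map_star, map_star, ← star_mul, ← star_mul,
    norm_star, norm_star] at this
  exact this

/-- An extendible ⋆-homomorphism carries conjugation by a unitary multiplier to conjugation by
a unitary multiplier. -/
theorem Extendible.exists_unitary_smul [PartialOrder A] [StarOrderedRing A]
    [TopologicalSpace.SeparableSpace A] {φ : A →⋆ₙₐ[ℂ] B} (hφ : Extendible φ)
    (v : unitary 𝓜(ℂ, A)) : ∃ w : unitary 𝓜(ℂ, B), ∀ a, φ (v • a) = w • φ a := by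
  obtain ⟨e, he⟩ := exists_isIncreasingApproximateUnit_nat A
  obtain ⟨P, hP⟩ := hφ.exists_strict_limit he
  have hcont : Continuous φ := (lipschitzWith_one_starAlgHom φ).continuous
  have he1 : ∀ a, Tendsto (fun n => e n * a) atTop (𝓝 a) := fun a => (he.2.2.2 a).1
  have he2 : ∀ a, Tendsto (fun n => a * e n) atTop (𝓝 a) := fun a => (he.2.2.2 a).2
  have hesa : ∀ n, star (e n) = e n := fun n => (he.2.1 n).isSelfAdjoint.star_eq
  set V : 𝓜(ℂ, A) := (v : 𝓜(ℂ, A)) with hV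
  have hL : ∀ b, ∃ l, Tendsto (fun n => φ (V.fst (e n)) * b) atTop (𝓝 l) := fun b => by
    refine cauchySeq_tendsto_of_complete (Metric.cauchySeq_iff'.2 fun ε hε => ?_)
    obtain ⟨N, hN⟩ := Metric.cauchySeq_iff'.1 (hP b).1.cauchySeq ε hε
    refine ⟨N, fun n hn => ?_⟩
    have := hN n hn
    rw [dist_eq_norm, ← sub_mul, ← map_sub] at this ⊢
    rwa [← map_sub, norm_map_fst_unitary_mul]
  have hR : ∀ b, ∃ l, Tendsto (fun n => b * φ (V.snd (e n))) atTop (𝓝 l) := fun b => by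
    refine cauchySeq_tendsto_of_complete (Metric.cauchySeq_iff'.2 fun ε hε => ?_)
    obtain ⟨N, hN⟩ := Metric.cauchySeq_iff'.1 (hP b).2.cauchySeq ε hε
    refine ⟨N, fun n hn => ?_⟩
    have := hN n hn
    rw [dist_eq_norm, ← mul_sub, ← map_sub] at this ⊢
    rwa [← map_sub, norm_mul_map_snd_unitary]
  choose L hL using hL
  choose R hR using hR
  have hLφ : ∀ c b, L (φ c * b) = φ (V.fst c) * b := fun c b => by
    refine tendsto_nhds_unique (hL _) ?_
    have h := (((hcont.tendsto _).comp ((V.fst.continuous.tendsto _).comp (he1 c))).mul_const b)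
    refine h.congr fun n => ?_
    simp [fst_mul, mul_assoc]
  have hRφ' : ∀ b c, R (b * φ c) = b * φ (V.snd c) := fun b c => by
    refine tendsto_nhds_unique (hR _) ?_
    have h := ((hcont.tendsto _).comp ((V.snd.continuous.tendsto _).comp (he2 c))).const_mul b
    refine h.congr fun n => ?_
    simp [snd_mul, mul_assoc]
  have hPφ : ∀ c, P.fst (φ c) = φ c := fun c => by
    refine tendsto_nhds_unique (hP _).1 ?_
    exact ((hcont.tendsto _).comp (he1 c)).congr fun n => by simp
  have hPφ' : ∀ c, P.snd (φ c) = φ c := fun c => by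
    refine tendsto_nhds_unique (hP _).2 ?_
    exact ((hcont.tendsto _).comp (he2 c)).congr fun n => by simp
  have hPR : ∀ b, P.snd (R b) = R b := fun b => by
    refine tendsto_nhds_unique ((P.snd.continuous.tendsto _).comp (hR b)) ?_
    refine (hR b).congr fun n => ?_
    simp [snd_mul, hPφ']
  have hRφ : ∀ b c y, R b * (φ c * y) = b * (φ (V.fst c) * y) := fun b c y => by
    refine tendsto_nhds_unique ((hR b).mul_const (φ c * y)) ?_
    have h := ((hcont.tendsto _).comp (he1 (V.fst c))).mul_const y |>.const_mul b
    refine h.congr fun n => ?_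
    have : φ (V.snd (e n)) * φ c = φ (e n * V.fst c) := by rw [← map_mul, V.central]
    simp only [Function.comp_apply]
    rw [← this]
    simp [mul_assoc]
  have hcentral : ∀ b y, R b * y = b * L y := fun b y => by
    have h1 : Tendsto (fun n => R b * (φ (e n) * y)) atTop (𝓝 (R b * P.fst y)) :=
      (hP y).1.const_mul _
    rw [← P.central, hPR] at h1
    refine tendsto_nhds_unique h1 ?_
    exact ((hL y).const_mul b).congr fun n => (hRφ b (e n) y).symm
  let T : 𝓜(ℂ, B) :=
    { fst := continuousLinearMapOfTendsto
        (fun n => ContinuousLinearMap.mul ℂ B (φ (V.fst (e n)))) (tendsto_pi_nhds.2 hL)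
      snd := continuousLinearMapOfTendsto
        (fun n => (ContinuousLinearMap.mul ℂ B).flip (φ (V.snd (e n)))) (tendsto_pi_nhds.2 hR)
      central := hcentral }
  have hTfst : ∀ b, T.fst b = L b := fun _ => rfl
  have hTsnd : ∀ b, T.snd b = R b := fun _ => rfl
  have hext : ∀ S S' : 𝓜(ℂ, B), S * P = S → S' * P = S' →
      (∀ c, S * (φ c : 𝓜(ℂ, B)) = S' * (φ c : 𝓜(ℂ, B))) → S = S' := by
    intro S S' h1 h2 h
    rw [← h1, ← h2]
    refine ext_fst fun b => ?_
    change S.fst (P.fst b) = S'.fst (P.fst b)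
    refine tendsto_nhds_unique ((S.fst.continuous.tendsto _).comp (hP b).1)
      (((S'.fst.continuous.tendsto _).comp (hP b).1).congr fun n => ?_)
    have := h (e n)
    rw [mul_coe, mul_coe] at this
    simp only [Function.comp_apply, fst_mul]
    rw [coe_injective this]
  have hPc : ∀ c, P * (φ c : 𝓜(ℂ, B)) = φ c := fun c => by rw [mul_coe, hPφ]
  have hPP : P * P = P := by
    refine ext_fst fun b => ?_
    refine tendsto_nhds_unique ((P.fst.continuous.tendsto _).comp (hP b).1) ?_
    refine (hP b).1.congr fun n => ?_
    simp [fst_mul, hPφ]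
  have hPs : star P = P := by
    refine ext_fst fun b => ?_
    rw [star_fst]
    refine tendsto_nhds_unique (hP (star b)).2.star ?_
    simpa [← map_star, hesa] using! (hP b).1
  have hTP : T * P = T := by
    refine ext_fst fun b => ?_
    refine tendsto_nhds_unique ((T.fst.continuous.tendsto _).comp (hP b).1) ?_
    exact (hL b).congr fun n => (hLφ _ _).symm
  have hPT : P * T = T := by
    refine ext_snd fun b => ?_
    change T.snd (P.snd b) = T.snd b
    refine tendsto_nhds_unique ((T.snd.continuous.tendsto _).comp (hP b).2) ?_
    exact (hR b).congr fun n => (hRφ' _ _).symm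
  have hTc : ∀ c, T * (φ c : 𝓜(ℂ, B)) = (φ (V.fst c) : B) := fun c => by
    rw [mul_coe, hTfst]
    congr 1
    refine tendsto_nhds_unique (hL _) ?_
    have h := (hcont.tendsto _).comp ((V.fst.continuous.tendsto _).comp (he1 c))
    refine h.congr fun n => ?_
    simp [fst_mul]
  have hTc' : ∀ c, (φ c : 𝓜(ℂ, B)) * T = (φ (V.snd c) : B) := fun c => by
    rw [coe_mul, hTsnd]
    congr 1
    refine tendsto_nhds_unique (hR _) ?_
    have h := (hcont.tendsto _).comp ((V.snd.continuous.tendsto _).comp (he2 c))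
    refine h.congr fun n => ?_
    simp [snd_mul]
  have hTsc : ∀ c, star T * (φ c : 𝓜(ℂ, B)) = (φ ((star V).fst c) : B) := fun c => by
    rw [← star_inj, star_mul, star_star, ← coe_map_star, ← coe_map_star, ← map_star, ← map_star,
      hTc', star_fst, star_star]
  have hTsP : star T * P = star T := by rw [← hPs, ← star_mul, hPT]
  have hPTs : P * star T = star T := by rw [← hPs, ← star_mul, hTP]
  have hVs : ∀ c, (star V).fst (V.fst c) = c := fun c => by
    change (star V * V).fst c = c
    rw [hV, Unitary.coe_star_mul_self]
    rfl
  have hVs' : ∀ c, V.fst ((star V).fst c) = c := fun c => by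
    change (V * star V).fst c = c
    rw [hV, Unitary.mul_star_self_of_mem v.2]
    rfl
  have hTT : star T * T = P := by
    refine hext _ _ (by rw [mul_assoc, hTP]) hPP fun c => ?_
    rw [mul_assoc, hTc, hTsc, hVs, hPc]
  have hTT' : T * star T = P := by
    refine hext _ _ (by rw [mul_assoc, hTsP]) hPP fun c => ?_
    rw [mul_assoc, hTsc, hTc, hVs', hPc]
  have hW : T + (1 - P) ∈ unitary 𝓜(ℂ, B) := by
    rw [Unitary.mem_iff]
    constructor
    all_goals
      simp only [star_add, star_sub, star_one, hPs, add_mul, mul_add, sub_mul, mul_sub, one_mul,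
        mul_one, hTT, hTT', hTP, hPT, hTsP, hPTs, hPP]
      abel
  have hWc : ∀ c, (T + (1 - P)) * (φ c : 𝓜(ℂ, B)) = (φ (V.fst c) : B) := fun c => by
    rw [add_mul, sub_mul, one_mul, hPc, sub_self, add_zero, hTc]
  refine ⟨⟨T + (1 - P), hW⟩, fun a => coe_injective ?_⟩
  beta_reduce
  rw [coe_unitary_smul, hWc, ← star_inj, star_mul, star_star, ← coe_map_star, ← coe_map_star,
    ← map_star, ← map_star, hWc, unitary_smul_def, star_snd, star_star]

end Multiplier

/-- If `φ : A → B` and `ψ : B → A` are extendible ⋆-homomorphisms between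
separable C⋆-algebras such that `ψ ∘ φ` is approximately unitarily equivalent to `id_A` and
`φ ∘ ψ` is approximately unitarily equivalent to `id_B`, then there is a ⋆-isomorphism
`Φ : A ≃ B` approximately unitarily equivalent to `φ`, whose inverse is approximately
unitarily equivalent to `ψ`. -/
theorem stmt1 {A B : Type*}
    [NonUnitalCStarAlgebra A] [PartialOrder A] [StarOrderedRing A]
    [NonUnitalCStarAlgebra B] [PartialOrder B] [StarOrderedRing B]
    [TopologicalSpace.SeparableSpace A] [TopologicalSpace.SeparableSpace B]
    (φ : A →⋆ₙₐ[ℂ] B) (ψ : B →⋆ₙₐ[ℂ] A)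
    (hφ : Extendible φ) (hψ : Extendible ψ)
    (h1 : ApproxUnitaryEquiv (fun a => ψ (φ a)) (id : A → A))
    (h2 : ApproxUnitaryEquiv (fun b => φ (ψ b)) (id : B → B)) :
    ∃ Φ : A ≃⋆ₐ[ℂ] B,
      ApproxUnitaryEquiv (⇑Φ) (⇑φ) ∧ ApproxUnitaryEquiv (⇑Φ.symm) (⇑ψ) := by
  have hφL : LipschitzWith 1 φ := lipschitzWith_one_starAlgHom φ
  have hψL : LipschitzWith 1 ψ := lipschitzWith_one_starAlgHom ψ
  have hψφ : LocallyEquiv (unitary 𝓜(ℂ, A)) (ψ ∘ φ) id :=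
    (approxUnitaryEquiv_iff_locallyEquiv (by simpa using hψL.comp hφL) .id).1 h1
  have hφψ : LocallyEquiv (unitary 𝓜(ℂ, B)) (φ ∘ ψ) id :=
    (approxUnitaryEquiv_iff_locallyEquiv (by simpa using hφL.comp hψL) .id).1 h2
  obtain ⟨h, Φ₀, hΦ₀, hiso, hsurj⟩ := exists_surjective_limit_of_locallyEquiv hφL hψL
    hφ.exists_unitary_smul hψ.exists_unitary_smul hψφ hφψ
  have hmul a b : Φ₀ (a * b) = Φ₀ a * Φ₀ b := tendsto_nhds_unique (hΦ₀ _) <|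
    ((hΦ₀ a).mul (hΦ₀ b)).congr fun n => by simp [DoubleCentralizer.unitary_smul_mul]
  have hadd a b : Φ₀ (a + b) = Φ₀ a + Φ₀ b := tendsto_nhds_unique (hΦ₀ _) <|
    ((hΦ₀ a).add (hΦ₀ b)).congr fun n => by simp [DoubleCentralizer.unitary_smul_add]
  have hstar a : Φ₀ (star a) = star (Φ₀ a) := tendsto_nhds_unique (hΦ₀ _) <|
    (hΦ₀ a).star.congr fun n => by simp [DoubleCentralizer.unitary_smul_star, map_star]
  have hsmul (c : ℂ) a : Φ₀ (c • a) = c • Φ₀ a := tendsto_nhds_unique (hΦ₀ _) <|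
    ((hΦ₀ a).const_smul c).congr fun n => by simp [DoubleCentralizer.unitary_smul_smul]
  let Φ : A ≃⋆ₐ[ℂ] B :=
    { Equiv.ofBijective Φ₀ ⟨hiso.injective, hsurj⟩ with
      map_mul' := hmul
      map_add' := hadd
      map_star' := hstar
      map_smul' := hsmul }
  have hΦ : Isometry Φ := hiso
  have hright : Function.RightInverse Φ.symm Φ := Φ.apply_symm_apply
  have hsymm : Isometry Φ.symm := hΦ.right_inv hright
  refine ⟨Φ, (approxUnitaryEquiv_iff_locallyEquiv hΦ.lipschitz hφL).2 ?_,
    (approxUnitaryEquiv_iff_locallyEquiv hsymm.lipschitz hψL).2 ?_⟩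
  · exact .symm (.of_tendsto (g := h) hΦ₀)
  · exact .of_inverse hψL hψ.exists_unitary_smul hψφ (h := h) hΦ₀ hright
end

section
/- Let A and B be separable C*-algebras, and let φ: A → B and ψ: B → A be extendible *-homomorphisms such that ψ ∘ φ is asymptotically unitarily equivalent to the identity map of A and φ ∘ ψ is asymptotically unitarily equivalent to the identity map of B. Then there exists a *-isomorphism Φ: A → B such that Φ is asymptotically unitarily equivalent to φ and the inverse isomorphism Φ⁻¹: B → A is asymptotically unitarily equivalent to ψ. -/
open Filter Topology MultiplierAlgebra

/-- Two maps `A → B` are asymptotically unitarily equivalent if there is a strictly continuous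
path `u : [0,∞) → U(𝓜(ℂ, B))` of unitaries with `u_t φ(a) u_t* → ψ(a)` in norm as `t → ∞`. -/
def AsympUnitaryEquiv {A B : Type*} [NonUnitalCStarAlgebra A] [NonUnitalCStarAlgebra B]
    (φ ψ : A → B) : Prop :=
  ∃ u : ℝ → unitary 𝓜(ℂ, B),
    (∀ b : B,
      ContinuousOn (fun t => ((u t : 𝓜(ℂ, B)) * (b : 𝓜(ℂ, B)))) (Set.Ici (0 : ℝ)) ∧
      ContinuousOn (fun t => ((b : 𝓜(ℂ, B)) * (u t : 𝓜(ℂ, B)))) (Set.Ici (0 : ℝ))) ∧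
    ∀ a : A,
      Tendsto
        (fun t => ‖(u t : 𝓜(ℂ, B)) * (φ a : 𝓜(ℂ, B)) * star (u t : 𝓜(ℂ, B)) - (ψ a : 𝓜(ℂ, B))‖)
        atTop (𝓝 (0 : ℝ))

namespace AsympIntertwining

section Multipliers

variable {B : Type*} [NonUnitalCStarAlgebra B]

lemma mul_coe (m : 𝓜(ℂ, B)) (b : B) : m * (b : 𝓜(ℂ, B)) = (m.fst b : 𝓜(ℂ, B)) := by
  ext x
  · change m.fst (b * x) = m.fst b * x
    have h : ∀ y, y * m.fst (b * x) = y * (m.fst b * x) := fun y => by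
      rw [← m.central, ← mul_assoc, ← mul_assoc, m.central]
    rw [← sub_eq_zero, ← CStarRing.star_mul_self_eq_zero_iff, mul_sub, sub_eq_zero]
    exact h _
  · exact m.central x b

lemma coe_mul (m : 𝓜(ℂ, B)) (b : B) : (b : 𝓜(ℂ, B)) * m = (m.snd b : 𝓜(ℂ, B)) := by
  ext x
  · exact (m.central b x).symm
  · change m.snd (x * b) = x * m.snd b
    have h : ∀ y, m.snd (x * b) * y = x * m.snd b * y := fun y => by
      rw [m.central, mul_assoc, mul_assoc, m.central]
    rw [← sub_eq_zero, ← CStarRing.mul_star_self_eq_zero_iff, sub_mul, sub_eq_zero]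
    exact h _

lemma coe_injective : Function.Injective (fun b : B => (b : 𝓜(ℂ, B))) := by
  intro x y h
  have h' : (x - y) * star (x - y) = 0 := by
    have := congrArg (fun m : 𝓜(ℂ, B) => m.fst (star (x - y))) h
    rw [sub_mul, sub_eq_zero]
    exact this
  exact sub_eq_zero.1 (CStarRing.mul_star_self_eq_zero_iff _ |>.1 h')

lemma norm_coe (b : B) : ‖(b : 𝓜(ℂ, B))‖ = ‖b‖ :=
  NonUnitalStarAlgHom.norm_map (DoubleCentralizer.coeHom (𝕜 := ℂ) (A := B)) coe_injective b

lemma isometry_coe : Isometry (fun b : B => (b : 𝓜(ℂ, B))) :=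
  AddMonoidHomClass.isometry_of_norm (DoubleCentralizer.coeHom (𝕜 := ℂ) (A := B)) norm_coe

lemma multiplier_ext {m n : 𝓜(ℂ, B)} (h : ∀ b : B, m * (b : 𝓜(ℂ, B)) = n * (b : 𝓜(ℂ, B))) :
    m = n := by
  have h1 : m.fst = n.fst := ContinuousLinearMap.ext fun b =>
    coe_injective (by simpa only [mul_coe] using h b)
  refine DoubleCentralizer.ext _ _ _ _ (Prod.ext h1 (ContinuousLinearMap.ext fun x => ?_))
  refine coe_injective ?_
  change ((m.snd x : B) : 𝓜(ℂ, B)) = ((n.snd x : B) : 𝓜(ℂ, B))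
  rw [← coe_mul, ← coe_mul]
  ext y
  · change x * m.fst y = x * n.fst y
    rw [h1]
  · change m.snd (y * x) = n.snd (y * x)
    have h2 : ∀ z w, m.snd z * w = n.snd z * w := fun z w => by
      rw [m.central, n.central, h1]
    rw [← sub_eq_zero, ← CStarRing.mul_star_self_eq_zero_iff, sub_mul, sub_eq_zero]
    exact h2 _ _

lemma coe_star (b : B) : DoubleCentralizer.coe ℂ (star b) = star (DoubleCentralizer.coe ℂ b) :=
  map_star (DoubleCentralizer.coeHom (𝕜 := ℂ) (A := B)) b

/-- Conjugation of `B` by a unitary multiplier. -/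
noncomputable def conj (u : unitary 𝓜(ℂ, B)) : B →⋆ₙₐ[ℂ] B where
  toFun b := (u : 𝓜(ℂ, B)).fst ((star (u : 𝓜(ℂ, B))).snd b)
  map_smul' c x := by simp only [map_smul]; rfl
  map_zero' := by simp only [map_zero]
  map_add' x y := by simp only [map_add]
  map_mul' x y := by
    refine coe_injective ?_
    have hm : ∀ a b : B, ((a * b : B) : 𝓜(ℂ, B)) = (a : 𝓜(ℂ, B)) * (b : 𝓜(ℂ, B)) :=
      map_mul (DoubleCentralizer.coeHom (𝕜 := ℂ) (A := B))
    simp only [hm, ← mul_coe, ← coe_mul]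
    have h : star (u : 𝓜(ℂ, B)) * (u : 𝓜(ℂ, B)) = 1 := Unitary.coe_star_mul_self u
    calc _ = (u : 𝓜(ℂ, B)) * x * 1 * y * star (u : 𝓜(ℂ, B)) := by
            simp only [mul_one, mul_assoc]
      _ = _ := by rw [← h]; simp only [mul_assoc]
  map_star' x := by
    refine coe_injective ?_
    simp only [coe_star, ← mul_coe, ← coe_mul, star_mul, star_star, mul_assoc]

lemma coe_conj (u : unitary 𝓜(ℂ, B)) (b : B) :
    (conj u b : 𝓜(ℂ, B)) = (u : 𝓜(ℂ, B)) * (b : 𝓜(ℂ, B)) * star (u : 𝓜(ℂ, B)) := by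
  rw [mul_assoc, coe_mul, mul_coe]
  rfl

lemma conj_mul (u v : unitary 𝓜(ℂ, B)) (b : B) : conj (u * v) b = conj u (conj v b) := by
  refine coe_injective ?_
  simp only [coe_conj, Submonoid.coe_mul, star_mul, mul_assoc]

@[simp]
lemma conj_one (b : B) : conj (1 : unitary 𝓜(ℂ, B)) b = b := by
  refine coe_injective ?_
  simp only [coe_conj, OneMemClass.coe_one, star_one, mul_one, one_mul]

@[simp]
lemma conj_star_conj (u : unitary 𝓜(ℂ, B)) (b : B) : conj (star u) (conj u b) = b := by
  rw [← conj_mul, Unitary.star_mul_self, conj_one]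

@[simp]
lemma conj_conj_star (u : unitary 𝓜(ℂ, B)) (b : B) : conj u (conj (star u) b) = b := by
  rw [← conj_mul, Unitary.mul_star_self, conj_one]

@[simp]
lemma norm_conj (u : unitary 𝓜(ℂ, B)) (b : B) : ‖conj u b‖ = ‖b‖ :=
  NonUnitalStarAlgHom.norm_map _ (Function.LeftInverse.injective (conj_star_conj u)) b

lemma norm_conj_sub_conj (u : unitary 𝓜(ℂ, B)) (x y : B) : ‖conj u x - conj u y‖ = ‖x - y‖ := by
  rw [← map_sub, norm_conj]

lemma norm_conj_star_sub (u : unitary 𝓜(ℂ, B)) (x y : B) :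
    ‖conj (star u) x - y‖ = ‖conj u y - x‖ := by
  rw [← norm_conj_sub_conj u, conj_conj_star, norm_sub_rev]

/-- Strict continuity of a path of unitary multipliers. -/
def StrictContinuous (u : ℝ → unitary 𝓜(ℂ, B)) : Prop :=
  ∀ b : B, Continuous (fun t => (u t : 𝓜(ℂ, B)).fst b) ∧
    Continuous (fun t => (u t : 𝓜(ℂ, B)).snd b)

lemma norm_unitary_le_one (u : unitary 𝓜(ℂ, B)) : ‖(u : 𝓜(ℂ, B))‖ ≤ 1 := by
  rcases subsingleton_or_nontrivial 𝓜(ℂ, B) with h | h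
  · rw [Subsingleton.elim (u : 𝓜(ℂ, B)) 0, norm_zero]
    exact zero_le_one
  · exact (CStarRing.norm_coe_unitary u).le

lemma norm_fst_le (u : unitary 𝓜(ℂ, B)) (b : B) : ‖(u : 𝓜(ℂ, B)).fst b‖ ≤ ‖b‖ := by
  refine ((u : 𝓜(ℂ, B)).fst.le_opNorm b).trans ?_
  rw [DoubleCentralizer.norm_fst]
  exact mul_le_of_le_one_left (norm_nonneg b) (norm_unitary_le_one u)

lemma norm_snd_le (u : unitary 𝓜(ℂ, B)) (b : B) : ‖(u : 𝓜(ℂ, B)).snd b‖ ≤ ‖b‖ := by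
  refine ((u : 𝓜(ℂ, B)).snd.le_opNorm b).trans ?_
  rw [DoubleCentralizer.norm_snd]
  exact mul_le_of_le_one_left (norm_nonneg b) (norm_unitary_le_one u)

/-- A pointwise continuous family of linear contractions, applied to a continuous path,
is continuous. -/
lemma continuous_apply_of_contraction {f : ℝ → B →L[ℂ] B} (hf : ∀ b, Continuous fun t => f t b)
    (hn : ∀ t b, ‖f t b‖ ≤ ‖b‖) {g : ℝ → B} (hg : Continuous g) :
    Continuous fun t => f t (g t) := by
  rw [continuous_iff_continuousAt]
  intro s
  have h1 : Tendsto (fun t => f t (g t - g s)) (𝓝 s) (𝓝 0) := by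
    refine squeeze_zero_norm (fun t => hn t _) ?_
    simpa using (hg.tendsto s).sub_const (g s) |>.norm
  have h2 := h1.add ((hf (g s)).tendsto s)
  simpa [ContinuousAt] using h2

namespace StrictContinuous

lemma const (u : unitary 𝓜(ℂ, B)) : StrictContinuous fun _ => u :=
  fun _ => ⟨continuous_const, continuous_const⟩

lemma comp {u : ℝ → unitary 𝓜(ℂ, B)} (hu : StrictContinuous u) {f : ℝ → ℝ} (hf : Continuous f) :
    StrictContinuous fun t => u (f t) :=
  fun b => ⟨(hu b).1.comp hf, (hu b).2.comp hf⟩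

lemma mul {u v : ℝ → unitary 𝓜(ℂ, B)} (hu : StrictContinuous u) (hv : StrictContinuous v) :
    StrictContinuous fun t => u t * v t :=
  fun b => ⟨continuous_apply_of_contraction (fun c => (hu c).1) (fun t => norm_fst_le (u t))
      (hv b).1,
    continuous_apply_of_contraction (fun c => (hv c).2) (fun t => norm_snd_le (v t)) (hu b).2⟩

lemma star {u : ℝ → unitary 𝓜(ℂ, B)} (hu : StrictContinuous u) :
    StrictContinuous fun t => star (u t) :=
  fun b => ⟨continuous_star.comp (hu (Star.star b)).2, continuous_star.comp (hu (Star.star b)).1⟩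

lemma of_eventuallyEq {w : ℝ → unitary 𝓜(ℂ, B)}
    (h : ∀ t, ∃ u, StrictContinuous u ∧ w =ᶠ[𝓝 t] u) : StrictContinuous w := by
  refine fun b => ⟨continuous_iff_continuousAt.2 fun t => ?_,
    continuous_iff_continuousAt.2 fun t => ?_⟩ <;> obtain ⟨u, hu, he⟩ := h t
  · refine ((hu b).1.continuousAt (x := t)).congr ?_
    filter_upwards [he] with s hs
    rw [hs]
  · refine ((hu b).2.continuousAt (x := t)).congr ?_
    filter_upwards [he] with s hs
    rw [hs]

end StrictContinuous

lemma asympUnitaryEquiv_iff {A : Type*} [NonUnitalCStarAlgebra A] {φ ψ : A → B} :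
    AsympUnitaryEquiv φ ψ ↔ ∃ u : ℝ → unitary 𝓜(ℂ, B), StrictContinuous u ∧
      ∀ a, Tendsto (fun t => conj (u t) (φ a)) atTop (𝓝 (ψ a)) := by
  have key : ∀ (u : unitary 𝓜(ℂ, B)) (x y : B),
      ‖(u : 𝓜(ℂ, B)) * (x : 𝓜(ℂ, B)) * star (u : 𝓜(ℂ, B)) - (y : 𝓜(ℂ, B))‖ = ‖conj u x - y‖ := by
    intro u x y
    rw [← coe_conj, ← dist_eq_norm, ← dist_eq_norm]
    exact isometry_coe.dist_eq _ _
  have cont : ∀ (S : Set ℝ) (f : ℝ → B),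
      ContinuousOn (fun t => (f t : 𝓜(ℂ, B))) S ↔ ContinuousOn f S := fun S f =>
    isometry_coe.isUniformInducing.isInducing.continuousOn_iff.symm
  unfold AsympUnitaryEquiv
  simp only [key]
  simp only [mul_coe, coe_mul, cont]
  constructor
  · rintro ⟨u, hu, h⟩
    refine ⟨fun t => u (max t 0), fun b => ?_, fun a => ?_⟩
    · have hm : Continuous fun t : ℝ => max t 0 := continuous_id.max continuous_const
      exact ⟨(hu b).1.comp_continuous hm fun t => Set.mem_Ici.2 (le_max_right _ _),
        (hu b).2.comp_continuous hm fun t => Set.mem_Ici.2 (le_max_right _ _)⟩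
    · have := tendsto_iff_norm_sub_tendsto_zero.2 (h a)
      refine this.congr' ?_
      filter_upwards [eventually_ge_atTop 0] with t ht
      rw [max_eq_left ht]
  · rintro ⟨u, hu, h⟩
    exact ⟨u, fun b => ⟨(hu b).1.continuousOn, (hu b).2.continuousOn⟩,
      fun a => tendsto_iff_norm_sub_tendsto_zero.1 (h a)⟩

end Multipliers

section ApproximateUnit

variable {A : Type*} [NonUnitalCStarAlgebra A] [PartialOrder A] [StarOrderedRing A]

lemma exists_sequential_approximateUnit [TopologicalSpace.SeparableSpace A] :
    ∃ e : ℕ → A, IsIncreasingApproximateUnit e := by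
  obtain ⟨d, hd⟩ := TopologicalSpace.exists_dense_seq A
  have hl := CStarAlgebra.increasingApproximateUnit A
  have hx : ∀ n : ℕ, ∃ x : A, (0 ≤ x ∧ ‖x‖ < 1) ∧ ∀ y, x ≤ y → ‖y‖ ≤ 1 →
      ∀ k ∈ Finset.range (n + 1), ‖y * d k - d k‖ < ((n : ℝ) + 1)⁻¹ ∧
        ‖d k * y - d k‖ < ((n : ℝ) + 1)⁻¹ := by
    intro n
    have hn : (0 : ℝ) < ((n : ℝ) + 1)⁻¹ := by positivity
    have h : ∀ᶠ y in CStarAlgebra.approximateUnit A, ∀ k ∈ Finset.range (n + 1),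
        ‖y * d k - d k‖ < ((n : ℝ) + 1)⁻¹ ∧ ‖d k * y - d k‖ < ((n : ℝ) + 1)⁻¹ := by
      rw [Filter.eventually_all_finset]
      intro k _
      have h1 := (Metric.tendsto_nhds.1 (hl.tendsto_mul_right (d k))) _ hn
      have h2 := (Metric.tendsto_nhds.1 (hl.tendsto_mul_left (d k))) _ hn
      simp only [dist_eq_norm] at h1 h2
      exact h1.and h2
    obtain ⟨x, hx, hy⟩ := (CStarAlgebra.hasBasis_approximateUnit A).eventually_iff.1 h
    exact ⟨x, hx, fun y hxy hy1 => hy ⟨hxy, by simpa using hy1⟩⟩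
  choose x hx0 hx1 using hx
  let S : Type _ := {y : A // 0 ≤ y ∧ ‖y‖ < 1}
  have hdir : ∀ a b : S, ∃ c : S, a.1 ≤ c.1 ∧ b.1 ≤ c.1 := by
    intro a b
    obtain ⟨c, hc, hac, hbc⟩ := CStarAlgebra.directedOn_nonneg_ball a.1 ⟨a.2.1, by simpa using a.2.2⟩
      b.1 ⟨b.2.1, by simpa using b.2.2⟩
    exact ⟨⟨c, hc.1, by simpa using hc.2⟩, hac, hbc⟩
  choose ub hub1 hub2 using hdir
  let e : ℕ → S := fun n => Nat.rec ⟨x 0, hx0 0⟩ (fun n y => ub y ⟨x (n + 1), hx0 (n + 1)⟩) n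
  have hmono : Monotone fun n => (e n).1 := monotone_nat_of_le_succ fun n => hub1 _ _
  have hge : ∀ n, x n ≤ (e n).1 := by
    intro n
    cases n with
    | zero => exact le_rfl
    | succ n => exact hub2 (e n) ⟨x (n + 1), hx0 (n + 1)⟩
  have hclose : ∀ k n m, k ≤ n → n ≤ m → ‖(e m).1 * d k - d k‖ < ((n : ℝ) + 1)⁻¹ ∧
      ‖d k * (e m).1 - d k‖ < ((n : ℝ) + 1)⁻¹ := fun k n m hkn hnm =>
    hx1 n _ ((hge n).trans (hmono hnm)) (e m).2.2.le k (Finset.mem_range.2 (by omega))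
  have happrox : ∀ (a : A) (ε : ℝ), 0 < ε → ∃ N, ∀ m ≥ N, ‖(e m).1 * a - a‖ < ε ∧
      ‖a * (e m).1 - a‖ < ε := by
    intro a ε hε
    obtain ⟨k, hk⟩ := hd.exists_dist_lt a (show 0 < ε / 3 by positivity)
    rw [dist_eq_norm] at hk
    obtain ⟨n, hn⟩ := exists_nat_one_div_lt (show 0 < ε / 3 by positivity)
    rw [one_div] at hn
    refine ⟨max k n, fun m hm => ?_⟩
    have hc := hclose k (max k n) m (le_max_left _ _) hm
    have hle : (((max k n : ℕ) : ℝ) + 1)⁻¹ ≤ ((n : ℝ) + 1)⁻¹ := by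
      gcongr
      exact le_max_right _ _
    have he : ‖(e m).1‖ ≤ 1 := (e m).2.2.le
    constructor
    · have h1 : (e m).1 * a - a =
          (e m).1 * (a - d k) + ((e m).1 * d k - d k) - (a - d k) := by
        rw [mul_sub]; abel
      have h2 : ‖(e m).1 * (a - d k)‖ ≤ ‖a - d k‖ :=
        (norm_mul_le _ _).trans (mul_le_of_le_one_left (norm_nonneg _) he)
      rw [h1]
      linarith [norm_sub_le ((e m).1 * (a - d k) + ((e m).1 * d k - d k)) (a - d k),
        norm_add_le ((e m).1 * (a - d k)) ((e m).1 * d k - d k), hc.1]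
    · have h1 : a * (e m).1 - a =
          (a - d k) * (e m).1 + (d k * (e m).1 - d k) - (a - d k) := by
        rw [sub_mul]; abel
      have h2 : ‖(a - d k) * (e m).1‖ ≤ ‖a - d k‖ :=
        (norm_mul_le _ _).trans (mul_le_of_le_one_right (norm_nonneg _) he)
      rw [h1]
      linarith [norm_sub_le ((a - d k) * (e m).1 + (d k * (e m).1 - d k)) (a - d k),
        norm_add_le ((a - d k) * (e m).1) (d k * (e m).1 - d k), hc.2]
  refine ⟨fun n => (e n).1, hmono, fun n => (e n).2.1, fun n => (e n).2.2.le, fun a => ?_⟩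
  constructor <;> rw [Metric.tendsto_atTop] <;> intro ε hε <;> simp only [dist_eq_norm]
  · exact (happrox a ε hε).imp fun N h m hm => (h m hm).1
  · exact (happrox a ε hε).imp fun N h m hm => (h m hm).2

/-- The strict limit of the images of an approximate unit under an extendible homomorphism. -/
lemma exists_sequence_of_extendible [TopologicalSpace.SeparableSpace A]
    {B : Type*} [NonUnitalCStarAlgebra B] {φ : A →⋆ₙₐ[ℂ] B} (hφ : Extendible φ) :
    ∃ (e : ℕ → A) (p : 𝓜(ℂ, B)), IsIncreasingApproximateUnit e ∧
      ∀ b : B, Tendsto (fun n => φ (e n) * b) atTop (𝓝 (p.fst b)) ∧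
        Tendsto (fun n => b * φ (e n)) atTop (𝓝 (p.snd b)) := by
  obtain ⟨e, he⟩ := exists_sequential_approximateUnit (A := A)
  have hdown : Tendsto (ULift.down : ULift ℕ → ℕ) atTop atTop :=
    tendsto_atTop_atTop.2 fun n => ⟨⟨n⟩, fun _ h => h⟩
  have hup : Tendsto (ULift.up : ℕ → ULift ℕ) atTop atTop :=
    tendsto_atTop_atTop.2 fun n => ⟨n.down, fun _ h => h⟩
  obtain ⟨p, hp⟩ := hφ (ULift ℕ) (fun n => e n.down) ⟨fun _ _ h => he.1 h, fun _ => he.2.1 _,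
    fun _ => he.2.2.1 _, fun a => ⟨(he.2.2.2 a).1.comp hdown, (he.2.2.2 a).2.comp hdown⟩⟩
  refine ⟨e, p, he, fun b => ⟨?_, ?_⟩⟩
  · rw [isometry_coe.isUniformInducing.isInducing.tendsto_nhds_iff]
    refine ((hp b).1.comp hup).congr' (Eventually.of_forall fun n => ?_) |>.trans ?_
    · exact mul_coe _ _
    · rw [mul_coe]
  · rw [isometry_coe.isUniformInducing.isInducing.tendsto_nhds_iff]
    refine ((hp b).2.comp hup).congr' (Eventually.of_forall fun n => ?_) |>.trans ?_
    · exact coe_mul _ _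
    · rw [coe_mul]

end ApproximateUnit

lemma exists_tendsto_of_approx {T B : Type*} [NormedAddCommGroup B] [CompleteSpace B]
    {l : Filter T} [l.NeBot] {f : T → B}
    (h : ∀ ε > 0, ∃ (g : T → B) (c : B), Tendsto g l (𝓝 c) ∧ ∀ᶠ t in l, ‖f t - g t‖ ≤ ε) :
    ∃ c, Tendsto f l (𝓝 c) := by
  refine CompleteSpace.complete (f := map f l) (Metric.cauchy_iff.2 ⟨inferInstance, ?_⟩)
  intro ε hε
  obtain ⟨g, c, hg, hfg⟩ := h (ε / 4) (by positivity)
  refine ⟨Metric.ball c (ε / 2), ?_, fun x hx y hy => ?_⟩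
  · change ∀ᶠ t in l, f t ∈ Metric.ball c (ε / 2)
    filter_upwards [hfg, Metric.tendsto_nhds.1 hg (ε / 4) (by positivity)] with t h1 h2
    rw [← dist_eq_norm] at h1
    rw [Metric.mem_ball]
    linarith [dist_triangle (f t) (g t) c]
  · rw [Metric.mem_ball] at hx hy
    linarith [dist_triangle_right x y c]

section Extension

variable {A B : Type*} [NonUnitalCStarAlgebra A] [NonUnitalCStarAlgebra B]

lemma fst_mul (m : 𝓜(ℂ, A)) (x y : A) : m.fst (x * y) = m.fst x * y :=
  congrArg (fun n : 𝓜(ℂ, A) => n.fst y) (mul_coe m x)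

lemma snd_mul (m : 𝓜(ℂ, A)) (x y : A) : m.snd (x * y) = x * m.snd y :=
  congrArg (fun n : 𝓜(ℂ, A) => n.snd x) (coe_mul m y)

/-- `p` is the strict limit of the images under `φ` of the approximate unit `e`. -/
structure IsStrictUnitLimit (φ : A →⋆ₙₐ[ℂ] B) (e : ℕ → A) (p : 𝓜(ℂ, B)) : Prop where
  mul_left : ∀ a, Tendsto (fun n => e n * a) atTop (𝓝 a)
  mul_right : ∀ a, Tendsto (fun n => a * e n) atTop (𝓝 a)
  norm_le_one : ∀ n, ‖e n‖ ≤ 1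
  map_mul_left : ∀ b, Tendsto (fun n => φ (e n) * b) atTop (𝓝 (p.fst b))
  map_mul_right : ∀ b, Tendsto (fun n => b * φ (e n)) atTop (𝓝 (p.snd b))

/-- `M` acts on the image of `φ` as `m` does on `A`, and is supported on the corner of `p`. -/
structure IsMultiplierExtension (φ : A →⋆ₙₐ[ℂ] B) (p : 𝓜(ℂ, B)) (m : 𝓜(ℂ, A))
    (M : 𝓜(ℂ, B)) : Prop where
  mul_map : ∀ a, M * (φ a : 𝓜(ℂ, B)) = (φ (m.fst a) : 𝓜(ℂ, B))
  map_mul : ∀ a, (φ a : 𝓜(ℂ, B)) * M = (φ (m.snd a) : 𝓜(ℂ, B))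
  mul_proj : M * p = M
  proj_mul : p * M = M

variable {φ : A →⋆ₙₐ[ℂ] B} {e : ℕ → A} {p : 𝓜(ℂ, B)}

lemma continuous_hom (φ : A →⋆ₙₐ[ℂ] B) : Continuous φ :=
  AddMonoidHomClass.continuous_of_bound φ 1 fun a => by
    simpa using NonUnitalStarAlgHom.norm_apply_le φ a

namespace IsStrictUnitLimit

lemma proj_fst_map (h : IsStrictUnitLimit φ e p) (a : A) : p.fst (φ a) = φ a := by
  refine tendsto_nhds_unique (h.map_mul_left (φ a)) ?_
  simpa only [Function.comp_def, map_mul] using ((continuous_hom φ).tendsto _).comp (h.mul_left a)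

lemma proj_snd_map (h : IsStrictUnitLimit φ e p) (a : A) : p.snd (φ a) = φ a := by
  refine tendsto_nhds_unique (h.map_mul_right (φ a)) ?_
  simpa only [Function.comp_def, map_mul] using ((continuous_hom φ).tendsto _).comp (h.mul_right a)

lemma norm_fst_le (h : IsStrictUnitLimit φ e p) (m : 𝓜(ℂ, A)) (n : ℕ) :
    ‖φ (m.fst (e n))‖ ≤ ‖m‖ := by
  refine (NonUnitalStarAlgHom.norm_apply_le φ _).trans ((m.fst.le_opNorm _).trans ?_)
  rw [DoubleCentralizer.norm_fst]
  exact mul_le_of_le_one_right (norm_nonneg _) (h.norm_le_one n)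

lemma norm_snd_le (h : IsStrictUnitLimit φ e p) (m : 𝓜(ℂ, A)) (n : ℕ) :
    ‖φ (m.snd (e n))‖ ≤ ‖m‖ := by
  refine (NonUnitalStarAlgHom.norm_apply_le φ _).trans ((m.snd.le_opNorm _).trans ?_)
  rw [DoubleCentralizer.norm_snd]
  exact mul_le_of_le_one_right (norm_nonneg _) (h.norm_le_one n)

lemma exists_tendsto_left (h : IsStrictUnitLimit φ e p) (m : 𝓜(ℂ, A)) (b : B) :
    ∃ c, Tendsto (fun n => φ (m.fst (e n)) * b) atTop (𝓝 c) := by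
  refine exists_tendsto_of_approx fun ε hε => ?_
  have hm : 0 < ‖m‖ + 1 := by positivity
  obtain ⟨N, hN⟩ := ((Metric.tendsto_nhds.1 (h.map_mul_left b)) (ε / (‖m‖ + 1))
    (by positivity)).exists
  refine ⟨fun n => φ (m.fst (e n)) * (φ (e N) * b), φ (m.fst (e N)) * b, ?_,
    Eventually.of_forall fun n => ?_⟩
  · have h1 : Tendsto (fun n => φ (m.fst (e n * e N))) atTop (𝓝 (φ (m.fst (e N)))) :=
      ((continuous_hom φ).comp m.fst.continuous).tendsto _ |>.comp (h.mul_left (e N))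
    simpa only [fst_mul, map_mul, mul_assoc] using h1.mul_const b
  · have h1 : φ (m.fst (e n)) * b = φ (m.fst (e n)) * p.fst b := by
      rw [← p.central, h.proj_snd_map]
    rw [h1, ← mul_sub]
    rw [dist_comm, dist_eq_norm] at hN
    calc _ ≤ ‖φ (m.fst (e n))‖ * ‖p.fst b - φ (e N) * b‖ := norm_mul_le _ _
      _ ≤ (‖m‖ + 1) * (ε / (‖m‖ + 1)) := by
        gcongr
        exact (h.norm_fst_le m n).trans (by linarith)
      _ = ε := by field_simp

lemma exists_tendsto_right (h : IsStrictUnitLimit φ e p) (m : 𝓜(ℂ, A)) (b : B) :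
    ∃ c, Tendsto (fun n => b * φ (m.snd (e n))) atTop (𝓝 c) := by
  refine exists_tendsto_of_approx fun ε hε => ?_
  have hm : 0 < ‖m‖ + 1 := by positivity
  obtain ⟨N, hN⟩ := ((Metric.tendsto_nhds.1 (h.map_mul_right b)) (ε / (‖m‖ + 1))
    (by positivity)).exists
  refine ⟨fun n => b * φ (e N) * φ (m.snd (e n)), b * φ (m.snd (e N)), ?_,
    Eventually.of_forall fun n => ?_⟩
  · have h1 : Tendsto (fun n => φ (m.snd (e N * e n))) atTop (𝓝 (φ (m.snd (e N)))) :=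
      ((continuous_hom φ).comp m.snd.continuous).tendsto _ |>.comp (h.mul_right (e N))
    simpa only [snd_mul, map_mul, mul_assoc] using h1.const_mul b
  · have h1 : b * φ (m.snd (e n)) = p.snd b * φ (m.snd (e n)) := by
      rw [p.central, h.proj_fst_map]
    rw [h1, ← sub_mul]
    rw [dist_comm, dist_eq_norm] at hN
    calc _ ≤ ‖p.snd b - b * φ (e N)‖ * ‖φ (m.snd (e n))‖ := norm_mul_le _ _
      _ ≤ (ε / (‖m‖ + 1)) * (‖m‖ + 1) := by
        gcongr
        exact (h.norm_snd_le m n).trans (by linarith)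
      _ = ε := by field_simp

lemma exists_extension (h : IsStrictUnitLimit φ e p) (m : 𝓜(ℂ, A)) :
    ∃ M : 𝓜(ℂ, B), IsMultiplierExtension φ p m M := by
  choose l hl using h.exists_tendsto_left m
  choose r hr using h.exists_tendsto_right m
  let L : B →L[ℂ] B := continuousLinearMapOfTendsto
    (fun n => ContinuousLinearMap.mul ℂ B (φ (m.fst (e n)))) (f := l) (tendsto_pi_nhds.2 hl)
  let R : B →L[ℂ] B := continuousLinearMapOfTendsto
    (fun n => (ContinuousLinearMap.mul ℂ B).flip (φ (m.snd (e n)))) (f := r)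
    (tendsto_pi_nhds.2 hr)
  have hpl : ∀ b, p.fst (l b) = l b := fun b => by
    refine tendsto_nhds_unique (((p.fst.continuous.tendsto _).comp (hl b)).congr fun n => ?_)
      (hl b)
    rw [Function.comp_apply, fst_mul, h.proj_fst_map]
  have hlp : ∀ b, l (p.fst b) = l b := fun b => by
    refine tendsto_nhds_unique ((hl (p.fst b)).congr fun n => ?_) (hl b)
    rw [← p.central, h.proj_snd_map]
  have hrp : ∀ b, p.snd (r b) = r b := fun b => by
    refine tendsto_nhds_unique (((p.snd.continuous.tendsto _).comp (hr b)).congr fun n => ?_)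
      (hr b)
    rw [Function.comp_apply, snd_mul, h.proj_snd_map]
  have hmid : ∀ x y : A, x * m.fst y = m.snd x * y := fun x y => (m.central x y).symm
  let M : 𝓜(ℂ, B) := ⟨(L, R), fun x y => by
    change r x * y = x * l y
    have h1 : Tendsto (fun n => x * φ (e n) * (φ (m.fst (e n)) * y)) atTop
        (𝓝 (p.snd x * l y)) := (h.map_mul_right x).mul (hl y)
    have h2 : Tendsto (fun n => x * φ (m.snd (e n)) * (φ (e n) * y)) atTop
        (𝓝 (r x * p.fst y)) := (hr x).mul (h.map_mul_left y)
    have h3 := tendsto_nhds_unique (h1.congr fun n => by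
      rw [mul_assoc, ← mul_assoc (φ (e n)), ← map_mul, hmid, map_mul, mul_assoc (φ _),
        ← mul_assoc x]) h2
    rw [p.central, hpl, ← p.central, hrp] at h3
    exact h3.symm⟩
  have hM1 : ∀ b : B, M * (b : 𝓜(ℂ, B)) = (l b : 𝓜(ℂ, B)) := fun b => mul_coe M b
  have hM2 : ∀ b : B, (b : 𝓜(ℂ, B)) * M = (r b : 𝓜(ℂ, B)) := fun b => coe_mul M b
  refine ⟨M, fun a => ?_, fun a => ?_, ?_, ?_⟩
  · rw [hM1]
    congr 1
    refine tendsto_nhds_unique (hl _) ?_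
    have h1 : Tendsto (fun n => φ (m.fst (e n * a))) atTop (𝓝 (φ (m.fst a))) :=
      ((continuous_hom φ).comp m.fst.continuous).tendsto _ |>.comp (h.mul_left a)
    simpa only [fst_mul, map_mul] using h1
  · rw [hM2]
    congr 1
    refine tendsto_nhds_unique (hr _) ?_
    have h1 : Tendsto (fun n => φ (m.snd (a * e n))) atTop (𝓝 (φ (m.snd a))) :=
      ((continuous_hom φ).comp m.snd.continuous).tendsto _ |>.comp (h.mul_right a)
    simpa only [snd_mul, map_mul] using h1
  · refine multiplier_ext fun b => ?_
    rw [mul_assoc, mul_coe p, hM1, hM1, hlp]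
  · refine multiplier_ext fun b => ?_
    rw [mul_assoc, hM1, mul_coe p, hpl]

lemma extension_unique (h : IsStrictUnitLimit φ e p) {m : 𝓜(ℂ, A)} {M N : 𝓜(ℂ, B)}
    (hM : ∀ a, M * (φ a : 𝓜(ℂ, B)) = (φ (m.fst a) : 𝓜(ℂ, B))) (hM' : M * p = M)
    (hN : ∀ a, N * (φ a : 𝓜(ℂ, B)) = (φ (m.fst a) : 𝓜(ℂ, B))) (hN' : N * p = N) : M = N := by
  have key : ∀ K : 𝓜(ℂ, B), (∀ a, K * (φ a : 𝓜(ℂ, B)) = (φ (m.fst a) : 𝓜(ℂ, B))) →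
      K * p = K → ∀ b, Tendsto (fun n => φ (m.fst (e n)) * b) atTop (𝓝 (K.fst b)) := by
    intro K hK hK' b
    have h1 : K.fst b = K.fst (p.fst b) := by
      nth_rw 1 [← hK']
      rfl
    rw [h1]
    refine ((K.fst.continuous.tendsto _).comp (h.map_mul_left b)).congr fun n => ?_
    rw [Function.comp_apply, fst_mul]
    congr 1
    refine coe_injective ?_
    change ((K.fst (φ (e n)) : B) : 𝓜(ℂ, B)) = _
    rw [← mul_coe, hK]
  refine multiplier_ext fun b => ?_
  rw [mul_coe, mul_coe, tendsto_nhds_unique (key M hM hM' b) (key N hN hN' b)]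

lemma mul_proj_eq_proj (h : IsStrictUnitLimit φ e p) {K : 𝓜(ℂ, B)}
    (hK : ∀ a, K.fst (φ a) = φ a) : K * p = p := by
  refine multiplier_ext fun b => ?_
  rw [mul_assoc, mul_coe p, mul_coe K]
  congr 1
  refine tendsto_nhds_unique (((K.fst.continuous.tendsto _).comp (h.map_mul_left b)).congr
    fun n => ?_) (h.map_mul_left b)
  rw [Function.comp_apply, fst_mul, hK]

lemma proj_mul_proj (h : IsStrictUnitLimit φ e p) : p * p = p :=
  h.mul_proj_eq_proj h.proj_fst_map

lemma star_proj (h : IsStrictUnitLimit φ e p) : star p = p := by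
  have h1 : star p * p = p := h.mul_proj_eq_proj fun a => by
    rw [DoubleCentralizer.star_fst, ← map_star φ, h.proj_snd_map, map_star φ, star_star]
  rw [← h1, star_mul, star_star]

/-- An extendible homomorphism carries unitary multipliers to unitary multipliers, compatibly
with conjugation and with strict continuity of paths. -/
lemma exists_unitary_extension (h : IsStrictUnitLimit φ e p) :
    ∃ E : unitary 𝓜(ℂ, A) → unitary 𝓜(ℂ, B),
      (∀ u a, conj (E u) (φ a) = φ (conj u a)) ∧
        ∀ u, StrictContinuous u → StrictContinuous fun t => E (u t) := by
  choose E hE using h.exists_extension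
  have hpp := h.proj_mul_proj
  have hE_star : ∀ m, star (E m) = E (star m) := fun m => by
    refine h.extension_unique (m := star m) (fun a => ?_) ?_ (hE (star m)).mul_map
      (hE (star m)).mul_proj
    · have h1 := congrArg star ((hE m).map_mul (star a))
      rw [star_mul, ← coe_star, ← coe_star, ← map_star, ← map_star, star_star] at h1
      exact h1
    · rw [← h.star_proj, ← star_mul, (hE m).proj_mul]
  have hE_mul : ∀ m n, E m * E n = E (m * n) := fun m n => by
    refine h.extension_unique (m := m * n) (fun a => ?_) ?_ (hE (m * n)).mul_map
      (hE (m * n)).mul_proj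
    · rw [mul_assoc, (hE n).mul_map, (hE m).mul_map]
      rfl
    · rw [mul_assoc, (hE n).mul_proj]
  have hE_one : E 1 = p := by
    refine h.extension_unique (m := 1) (hE 1).mul_map (hE 1).mul_proj (fun a => ?_) hpp
    rw [mul_coe, h.proj_fst_map]
    rfl
  have hone : ∀ m n, m * n = 1 → (E m + (1 - p)) * (E n + (1 - p)) = 1 := fun m n hmn => by
    have h1 : E m * E n = p := by rw [hE_mul, hmn, hE_one]
    have h2 := (hE m).mul_proj
    have h3 := (hE n).proj_mul
    calc (E m + (1 - p)) * (E n + (1 - p))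
        = E m * E n + (E m - E m * p) + (E n - p * E n) + (1 - p - (p - p * p)) := by noncomm_ring
      _ = 1 := by rw [h1, h2, h3, hpp]; abel
  have hstar : ∀ m, star (E m + (1 - p)) = E (star m) + (1 - p) := fun m => by
    rw [star_add, star_sub, star_one, h.star_proj, hE_star]
  let U : unitary 𝓜(ℂ, A) → unitary 𝓜(ℂ, B) := fun u => ⟨E u + (1 - p), by
    rw [Unitary.mem_iff, hstar]
    exact ⟨hone _ _ (Unitary.coe_star_mul_self u), hone _ _ (Unitary.coe_mul_star_self u)⟩⟩
  have hUcoe : ∀ u, (U u : 𝓜(ℂ, B)) = E u + (1 - p) := fun u => rfl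
  have hUstar : ∀ u, star (U u) = U (star u) := fun u => Subtype.ext (hstar u)
  have hUfst : ∀ u a, (U u : 𝓜(ℂ, B)).fst (φ a) = φ ((u : 𝓜(ℂ, A)).fst a) := fun u a => by
    refine coe_injective ?_
    change ((((U u : 𝓜(ℂ, B)).fst (φ a)) : B) : 𝓜(ℂ, B)) = (φ ((u : 𝓜(ℂ, A)).fst a) : 𝓜(ℂ, B))
    rw [← mul_coe, hUcoe, add_mul, (hE u).mul_map, sub_mul, one_mul, mul_coe p, h.proj_fst_map,
      sub_self, add_zero]
  have hUsnd : ∀ u a, (U u : 𝓜(ℂ, B)).snd (φ a) = φ ((u : 𝓜(ℂ, A)).snd a) := fun u a => by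
    refine coe_injective ?_
    change ((((U u : 𝓜(ℂ, B)).snd (φ a)) : B) : 𝓜(ℂ, B)) = (φ ((u : 𝓜(ℂ, A)).snd a) : 𝓜(ℂ, B))
    rw [← coe_mul, hUcoe, mul_add, (hE u).map_mul, mul_sub, mul_one, coe_mul p, h.proj_snd_map,
      sub_self, add_zero]
  have hcont : ∀ u, StrictContinuous u → ∀ b, Continuous fun t => (U (u t) : 𝓜(ℂ, B)).fst b := by
    intro u hu b
    have hsplit : ∀ t, (U (u t) : 𝓜(ℂ, B)).fst b =
        (U (u t) : 𝓜(ℂ, B)).fst (p.fst b) + (b - p.fst b) := fun t => by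
      refine coe_injective ?_
      have hadd : ∀ x y : B, DoubleCentralizer.coe ℂ (x + y) =
          DoubleCentralizer.coe ℂ x + DoubleCentralizer.coe ℂ y :=
        map_add (DoubleCentralizer.coeHom (𝕜 := ℂ) (A := B))
      have hsub : ∀ x y : B, DoubleCentralizer.coe ℂ (x - y) =
          DoubleCentralizer.coe ℂ x - DoubleCentralizer.coe ℂ y :=
        map_sub (DoubleCentralizer.coeHom (𝕜 := ℂ) (A := B))
      simp only [hadd, hsub, ← mul_coe, hUcoe]
      rw [← mul_assoc _ p, add_mul _ _ p, (hE _).mul_proj, sub_mul 1 p p, hpp, one_mul, sub_self,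
        add_zero, add_mul, sub_mul, one_mul]
    simp only [hsplit]
    refine Continuous.add ?_ continuous_const
    refine continuous_of_uniform_approx_of_continuous fun V hV => ?_
    obtain ⟨ε, hε, hV⟩ := Metric.mem_uniformity_dist.1 hV
    obtain ⟨n, hn⟩ := ((Metric.tendsto_nhds.1 (h.map_mul_left b)) ε hε).exists
    refine ⟨fun t => φ ((u t : 𝓜(ℂ, A)).fst (e n)) * b,
      ((continuous_hom φ).comp (hu (e n)).1).mul continuous_const, fun t => hV ?_⟩
    rw [dist_comm, dist_eq_norm] at hn
    beta_reduce
    rw [← hUfst, ← fst_mul, dist_eq_norm, ← map_sub]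
    exact (AsympIntertwining.norm_fst_le _ _).trans_lt hn
  refine ⟨U, fun u a => ?_, fun u hu b => ⟨hcont u hu b, ?_⟩⟩
  · change (U u : 𝓜(ℂ, B)).fst ((star (U u) : unitary 𝓜(ℂ, B)).1.snd (φ a)) = _
    rw [hUstar, hUsnd, hUfst]
    rfl
  · refine (continuous_star.comp (hcont _ hu.star (star b))).congr fun t => ?_
    rw [Function.comp_apply, ← hUstar]
    change star (star ((U (u t) : 𝓜(ℂ, B)).snd (star (star b)))) = _
    rw [star_star, star_star]

end IsStrictUnitLimit

lemma exists_unitary_extension_of_extendible [PartialOrder A] [StarOrderedRing A]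
    [TopologicalSpace.SeparableSpace A] (hφ : Extendible φ) :
    ∃ E : unitary 𝓜(ℂ, A) → unitary 𝓜(ℂ, B),
      (∀ u a, conj (E u) (φ a) = φ (conj u a)) ∧
        ∀ u, StrictContinuous u → StrictContinuous fun t => E (u t) := by
  obtain ⟨e, p, he, hp⟩ := exists_sequence_of_extendible hφ
  exact IsStrictUnitLimit.exists_unitary_extension (e := e) (p := p)
    ⟨fun a => (he.2.2.2 a).1, fun a => (he.2.2.2 a).2, he.2.2.1, fun b => (hp b).1,
      fun b => (hp b).2⟩

end Extension

section Intertwining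

variable {A B : Type*} [NonUnitalCStarAlgebra A] [NonUnitalCStarAlgebra B]

lemma norm_conj_mul_sub_le {v w : unitary 𝓜(ℂ, B)} {x y z : B} {r s : ℝ}
    (hw : ‖conj w x - y‖ ≤ r) (hv : ‖conj v y - z‖ ≤ s) : ‖conj (v * w) x - z‖ ≤ r + s := by
  rw [conj_mul, ← sub_add_sub_cancel _ (conj v y)]
  refine (norm_add_le _ _).trans (add_le_add ?_ hv)
  rwa [norm_conj_sub_conj]

lemma eventually_norm_sub_le {T : Type*} {l : Filter T} {f : T → B} {c : B}
    (h : Tendsto f l (𝓝 c)) {ε : ℝ} (hε : 0 < ε) : ∀ᶠ t in l, ‖f t - c‖ ≤ ε := by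
  filter_upwards [Metric.tendsto_nhds.1 h ε hε] with t ht
  rw [← dist_eq_norm]
  exact ht.le

variable {φ : A →⋆ₙₐ[ℂ] B} {ψ : B →⋆ₙₐ[ℂ] A}

/-- A path of unitaries starting at `1`, almost commuting with `φ` on a finite set and moving
a given finite set close to the range of `φ`. -/
lemma exists_almost_commuting_path {u : ℝ → unitary 𝓜(ℂ, A)} {U v : ℝ → unitary 𝓜(ℂ, B)}
    (hU : StrictContinuous U) (hv : StrictContinuous v)
    (hUu : ∀ t a, conj (U t) (φ a) = φ (conj (u t) a))
    (hu_lim : ∀ a, Tendsto (fun t => conj (u t) (ψ (φ a))) atTop (𝓝 a))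
    (hv_lim : ∀ b, Tendsto (fun t => conj (v t) (φ (ψ b))) atTop (𝓝 b))
    (F : Finset A) (G : Finset B) {ε : ℝ} (hε : 0 < ε) :
    ∃ (z : ℝ → unitary 𝓜(ℂ, B)) (F' : Finset A), StrictContinuous z ∧ (∀ t ≤ 0, z t = 1) ∧
      (∀ t, 1 ≤ t → z t = z 1) ∧ (∀ a ∈ F, ∀ t, ‖conj (z t) (φ a) - φ a‖ ≤ ε) ∧
      ∀ b ∈ G, ∃ a ∈ F', ‖conj (star (z 1)) b - φ a‖ ≤ ε := by
  classical
  have hδ : 0 < ε / 4 := by positivity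
  have hU_lim : ∀ a, Tendsto (fun t => conj (U t) (φ (ψ (φ a)))) atTop (𝓝 (φ a)) := fun a => by
    simpa only [hUu, Function.comp_def] using ((continuous_hom φ).tendsto _).comp (hu_lim a)
  obtain ⟨s, hs⟩ := eventually_atTop.1 <|
    ((Filter.eventually_all_finset F).2 fun a _ => eventually_norm_sub_le (hv_lim (φ a)) hδ).and
    ((Filter.eventually_all_finset G).2 fun b _ => eventually_norm_sub_le (hv_lim b) hδ)
  obtain ⟨q, hq⟩ := eventually_atTop.1 <|
    (Filter.eventually_all_finset F).2 fun a _ => eventually_norm_sub_le (hU_lim a) hδ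
  set c : B → A := fun b => conj (u q) (ψ b) with hc
  obtain ⟨r, hqr, hr⟩ := ((eventually_ge_atTop q).and <|
    (Filter.eventually_all_finset G).2 fun b _ => eventually_norm_sub_le (hU_lim (c b)) hδ).exists
  obtain ⟨t, hst, ht⟩ := ((eventually_ge_atTop s).and <|
    (Filter.eventually_all_finset G).2 fun b _ =>
      eventually_norm_sub_le (hv_lim (φ (c b))) hδ).exists
  let σ : ℝ → ℝ := fun τ => max 0 (min τ 1)
  have hσ : Continuous σ := continuous_const.max (continuous_id.min continuous_const)
  have hσ0 : ∀ τ, 0 ≤ σ τ := fun τ => le_max_left _ _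
  have hσ1 : σ 1 = 1 := by simp [σ]
  refine ⟨fun τ => v s * (star (U q) * (U (q + σ τ * (r - q)) * star (v (s + σ τ * (t - s))))),
    G.image c, ?_, fun τ hτ => ?_, fun τ hτ => ?_, fun a ha τ => ?_, fun b hb => ?_⟩
  · exact (StrictContinuous.const _).mul <| (StrictContinuous.const _).mul <|
      (hU.comp (continuous_const.add (hσ.mul continuous_const))).mul
      (hv.comp (continuous_const.add (hσ.mul continuous_const))).star
  · have : σ τ = 0 := max_eq_left ((min_le_left _ _).trans hτ)
    simp only [this, zero_mul, add_zero]
    rw [← mul_assoc (star (U q)), Unitary.star_mul_self, one_mul, Unitary.mul_star_self]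
  · have : σ τ = σ 1 := by simp [σ, hτ]
    simp only [this]
  · have hr' : q ≤ q + σ τ * (r - q) := by nlinarith [hσ0 τ]
    have ht' : s ≤ s + σ τ * (t - s) := by nlinarith [hσ0 τ]
    have e1 := (hs _ ht').1 a ha
    have e2 := hq _ hr' a ha
    have e3 := hq q le_rfl a ha
    have e4 := (hs s le_rfl).1 a ha
    rw [← norm_conj_star_sub] at e1 e3
    refine (norm_conj_mul_sub_le (norm_conj_mul_sub_le (norm_conj_mul_sub_le e1 e2) e3)
      e4).trans (le_of_eq ?_)
    ring
  · refine ⟨c b, Finset.mem_image_of_mem _ hb, ?_⟩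
    have e1 := (hs s le_rfl).2 b hb
    have e2 : ‖conj (U q) (φ (ψ b)) - φ (c b)‖ ≤ 0 := by rw [hUu, sub_self, norm_zero]
    have e3 := hr b hb
    have e4 := ht b hb
    rw [← norm_conj_star_sub] at e1 e3
    simp only [hσ1, one_mul, add_sub_cancel, star_mul, star_star, mul_assoc]
    refine (norm_conj_mul_sub_le (norm_conj_mul_sub_le (norm_conj_mul_sub_le e1 e2) e3)
      e4).trans ?_
    linarith

/-- Unitaries `V n` and paths `z n` from `1` to `(V n)⁻¹ V (n + 1)` implementing a one-sided
approximate intertwining along `φ`. -/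
structure IsIntertwiningSequence (φ : A →⋆ₙₐ[ℂ] B) (a : ℕ → A) (b : ℕ → B)
    (V : ℕ → unitary 𝓜(ℂ, B)) (z : ℕ → ℝ → unitary 𝓜(ℂ, B)) (F : ℕ → Finset A) : Prop where
  zero : V 0 = 1
  succ : ∀ n, V (n + 1) = V n * z n 1
  continuous : ∀ n, StrictContinuous (z n)
  eq_one : ∀ n, ∀ t ≤ 0, z n t = 1
  eq_end : ∀ n t, 1 ≤ t → z n t = z n 1
  monotone : Monotone F
  mem : ∀ k n, k < n → a k ∈ F n
  commute : ∀ n, ∀ x ∈ F n, ∀ t, ‖conj (z n t) (φ x) - φ x‖ ≤ (1 / 2) ^ n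
  exists_near : ∀ k n, k ≤ n → ∃ x ∈ F (n + 1), ‖conj (V (n + 1)) (φ x) - b k‖ ≤ (1 / 2) ^ n

lemma exists_isIntertwiningSequence
    (hstep : ∀ (F : Finset A) (G : Finset B) (ε : ℝ), 0 < ε →
      ∃ (z : ℝ → unitary 𝓜(ℂ, B)) (F' : Finset A), StrictContinuous z ∧ (∀ t ≤ 0, z t = 1) ∧
        (∀ t, 1 ≤ t → z t = z 1) ∧ (∀ a ∈ F, ∀ t, ‖conj (z t) (φ a) - φ a‖ ≤ ε) ∧
        ∀ b ∈ G, ∃ a ∈ F', ‖conj (star (z 1)) b - φ a‖ ≤ ε)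
    (a : ℕ → A) (b : ℕ → B) :
    ∃ V z F, IsIntertwiningSequence φ a b V z F := by
  classical
  choose! Z F' hcont hone hend hcomm hnear using hstep
  let H : ℕ → Finset A → Finset A := fun n F => F ∪ (Finset.range (n + 1)).image a
  let G : ℕ → unitary 𝓜(ℂ, B) → Finset B := fun n V =>
    (Finset.range (n + 1)).image fun k => conj (star V) (b k)
  let S : ℕ → unitary 𝓜(ℂ, B) × Finset A := fun n => Nat.rec (1, ∅) (fun n p =>
    (p.1 * Z (H n p.2) (G n p.1) ((1 / 2) ^ n) 1,
      H n p.2 ∪ F' (H n p.2) (G n p.1) ((1 / 2) ^ n))) n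
  have hpos : ∀ n : ℕ, (0 : ℝ) < (1 / 2) ^ n := fun n => by positivity
  have hsub : ∀ n, H n (S n).2 ⊆ (S (n + 1)).2 := fun n => Finset.subset_union_left
  have hmono : Monotone fun n => (S n).2 :=
    monotone_nat_of_le_succ fun n => Finset.subset_union_left.trans (hsub n)
  refine ⟨fun n => (S n).1, fun n => Z (H n (S n).2) (G n (S n).1) ((1 / 2) ^ n),
    fun n => (S n).2, rfl, fun n => rfl, fun n => hcont _ _ _ (hpos n),
    fun n => hone _ _ _ (hpos n), fun n => hend _ _ _ (hpos n), hmono, fun k n hkn => ?_,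
    fun n x hx => hcomm _ _ _ (hpos n) x (Finset.subset_union_left hx), fun k n hkn => ?_⟩
  · exact hmono (Nat.succ_le_of_lt hkn) (hsub k (Finset.subset_union_right
      (Finset.mem_image_of_mem _ (Finset.mem_range.2 k.lt_succ_self))))
  · obtain ⟨x, hx, h⟩ := hnear (H n (S n).2) (G n (S n).1) _ (hpos n) (conj (star (S n).1) (b k))
      (Finset.mem_image_of_mem (fun k => conj (star (S n).1) (b k))
        (Finset.mem_range.2 (Nat.lt_succ_of_le hkn)))
    refine ⟨x, Finset.subset_union_right hx, ?_⟩
    rw [← conj_mul, ← star_mul, norm_conj_star_sub] at h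
    exact h

namespace IsIntertwiningSequence

variable {a : ℕ → A} {b : ℕ → B} {V : ℕ → unitary 𝓜(ℂ, B)} {z : ℕ → ℝ → unitary 𝓜(ℂ, B)}
  {F : ℕ → Finset A}

/-- The paths `z n` concatenate to a strictly continuous path through the unitaries `V n`. -/
lemma exists_path (h : IsIntertwiningSequence φ a b V z F) :
    ∃ w : ℝ → unitary 𝓜(ℂ, B), StrictContinuous w ∧ ∀ (n : ℕ), ∀ x ∈ F n, ∀ t : ℝ, n ≤ t →
      ‖conj (w t) (φ x) - conj (V n) (φ x)‖ ≤ 2 * (1 / 2) ^ n := by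
  let P : ℕ → ℝ → unitary 𝓜(ℂ, B) := fun N =>
    Nat.rec (fun _ => 1) (fun n p t => p t * z n (t - n)) N
  have hPsucc : ∀ N t, P (N + 1) t = P N t * z N (t - N) := fun N t => rfl
  have hPcont : ∀ N, StrictContinuous (P N) := fun N => by
    induction N with
    | zero => exact StrictContinuous.const 1
    | succ N ih => exact ih.mul ((h.continuous N).comp (continuous_id.sub continuous_const))
  have hPstable : ∀ (N M : ℕ) (t : ℝ), N ≤ M → t ≤ N → P M t = P N t := fun N M t hNM ht => by
    induction M, hNM using Nat.le_induction with
    | base => rfl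
    | succ M hM ih =>
      have : (N : ℝ) ≤ M := by exact_mod_cast hM
      rw [hPsucc, ih, h.eq_one M _ (by linarith), mul_one]
  have hPV : ∀ (N : ℕ) (t : ℝ), N ≤ t → P N t = V N := fun N => by
    induction N with
    | zero => exact fun t _ => h.zero.symm
    | succ N ih =>
      intro t ht
      push_cast at ht
      rw [hPsucc, ih t (by linarith), h.eq_end N _ (by linarith), h.succ]
  have hPdist : ∀ (n N : ℕ), n ≤ N → ∀ x ∈ F n, ∀ t,
      ‖conj (P N t) (φ x) - conj (P n t) (φ x)‖ ≤ 2 * (1 / 2) ^ n - 2 * (1 / 2) ^ N := by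
    intro n N hnN x hx t
    induction N, hnN using Nat.le_induction with
    | base => simp
    | succ N hN ih =>
      have h1 := h.commute N x (h.monotone hN hx) (t - N)
      rw [← norm_conj_sub_conj (P N t), ← conj_mul, ← hPsucc] at h1
      rw [← sub_add_sub_cancel _ (conj (P N t) (φ x))]
      refine (norm_add_le _ _).trans ((add_le_add h1 ih).trans (le_of_eq ?_))
      rw [pow_succ]
      ring
  refine ⟨fun t => P ⌈t⌉₊ t, StrictContinuous.of_eventuallyEq fun t =>
    ⟨P (⌈t⌉₊ + 1), hPcont (⌈t⌉₊ + 1), ?_⟩, fun n x hx t ht => ?_⟩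
  · have hlt : t < (⌈t⌉₊ + 1 : ℕ) := by
      push_cast
      linarith [Nat.le_ceil t]
    filter_upwards [eventually_lt_nhds hlt] with s hs
    exact (hPstable _ _ s (Nat.ceil_le.2 hs.le) (Nat.le_ceil s)).symm
  · have hn : n ≤ ⌈t⌉₊ := by exact_mod_cast ht.trans (Nat.le_ceil t)
    have h1 := hPdist n _ hn x hx t
    rw [hPV n t ht] at h1
    refine h1.trans (sub_le_self _ (by positivity))

end IsIntertwiningSequence

/-- One-sided approximate intertwining along a continuous path. -/
lemma exists_starAlgEquiv_of_isIntertwiningSequence (hφ : ∀ x, ‖φ x‖ = ‖x‖)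
    {a : ℕ → A} {b : ℕ → B} (ha : DenseRange a) (hb : DenseRange b)
    {V : ℕ → unitary 𝓜(ℂ, B)} {z : ℕ → ℝ → unitary 𝓜(ℂ, B)} {F : ℕ → Finset A}
    (h : IsIntertwiningSequence φ a b V z F) :
    ∃ (w : ℝ → unitary 𝓜(ℂ, B)) (Φ : A ≃⋆ₐ[ℂ] B), StrictContinuous w ∧
      ∀ x, Tendsto (fun t => conj (w t) (φ x)) atTop (𝓝 (Φ x)) := by
  obtain ⟨w, hw, hwV⟩ := h.exists_path
  have hsmall : ∀ ε : ℝ, 0 < ε → ∃ N : ℕ, ∀ n ≥ N, 2 * (1 / 2 : ℝ) ^ n < ε := fun ε hε => by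
    have h1 : Tendsto (fun n : ℕ => 2 * (1 / 2 : ℝ) ^ n) atTop (𝓝 (2 * 0)) :=
      (tendsto_pow_atTop_nhds_zero_of_lt_one (by norm_num) (by norm_num)).const_mul 2
    rw [mul_zero] at h1
    exact eventually_atTop.1 (h1.eventually_lt_const hε)
  have hlim : ∀ x, ∃ y, Tendsto (fun t => conj (w t) (φ x)) atTop (𝓝 y) := fun x => by
    refine exists_tendsto_of_approx fun ε hε => ?_
    obtain ⟨k, hk⟩ := ha.exists_dist_lt x (half_pos hε)
    obtain ⟨N, hN⟩ := hsmall (ε / 2) (half_pos hε)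
    set m := max N (k + 1)
    refine ⟨fun _ => conj (V m) (φ (a k)), _, tendsto_const_nhds, ?_⟩
    filter_upwards [eventually_ge_atTop (m : ℝ)] with t ht
    have h1 := hwV m (a k) (h.mem k m (lt_of_lt_of_le k.lt_succ_self (le_max_right _ _))) t ht
    have h2 : ‖conj (w t) (φ x) - conj (w t) (φ (a k))‖ < ε / 2 := by
      rw [norm_conj_sub_conj, ← map_sub, hφ, ← dist_eq_norm]
      exact hk
    rw [← sub_add_sub_cancel _ (conj (w t) (φ (a k)))]
    linarith [norm_add_le (conj (w t) (φ x) - conj (w t) (φ (a k)))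
      (conj (w t) (φ (a k)) - conj (V m) (φ (a k))), hN m (le_max_left _ _)]
  choose Ψ hΨ using hlim
  let Φ : A →⋆ₙₐ[ℂ] B :=
    { toFun := Ψ
      map_smul' := fun c x => tendsto_nhds_unique (hΨ (c • x)) <| by
        simpa only [map_smul, MonoidHom.id_apply] using (hΨ x).const_smul c
      map_zero' := tendsto_nhds_unique (hΨ 0) <| by simp
      map_add' := fun x y => tendsto_nhds_unique (hΨ (x + y)) <| by
        simpa only [map_add] using (hΨ x).add (hΨ y)
      map_mul' := fun x y => tendsto_nhds_unique (hΨ (x * y)) <| by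
        simpa only [map_mul] using (hΨ x).mul (hΨ y)
      map_star' := fun x => tendsto_nhds_unique (hΨ (star x)) <| by
        simpa only [map_star] using (hΨ x).star }
  have hnorm : ∀ x, ‖Φ x‖ = ‖x‖ := fun x => by
    refine tendsto_nhds_unique (hΨ x).norm ?_
    simp only [norm_conj, hφ]
    exact tendsto_const_nhds
  have hiso : Isometry Φ := AddMonoidHomClass.isometry_of_norm Φ hnorm
  have hdense : DenseRange Φ := fun y => by
    refine Metric.mem_closure_iff.2 fun ε hε => ?_
    obtain ⟨k, hk⟩ := hb.exists_dist_lt y (half_pos hε)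
    obtain ⟨N, hN⟩ := hsmall (ε / 2) (half_pos hε)
    set m := max N k
    obtain ⟨x, hx, hxb⟩ := h.exists_near k m (le_max_right _ _)
    have h1 : ‖Φ x - conj (V (m + 1)) (φ x)‖ ≤ 2 * (1 / 2) ^ (m + 1) := by
      refine le_of_tendsto ((hΨ x).sub_const _).norm ?_
      filter_upwards [eventually_ge_atTop ((m + 1 : ℕ) : ℝ)] with t ht
      exact hwV (m + 1) x hx t ht
    rw [pow_succ] at h1
    refine ⟨Φ x, Set.mem_range_self x, ?_⟩
    have h2 : dist (b k) (Φ x) ≤ 2 * (1 / 2) ^ m := by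
      rw [dist_comm, dist_eq_norm, ← sub_add_sub_cancel _ (conj (V (m + 1)) (φ x))]
      linarith [norm_add_le (Φ x - conj (V (m + 1)) (φ x)) (conj (V (m + 1)) (φ x) - b k)]
    linarith [dist_triangle y (b k) (Φ x), hN m (le_max_left _ _)]
  have hsurj : Function.Surjective Φ := by
    rw [← Set.range_eq_univ, ← hdense.closure_range,
      hiso.isClosedEmbedding.isClosed_range.closure_eq]
  exact ⟨w, StarAlgEquiv.ofBijective Φ ⟨hiso.injective, hsurj⟩, hw, hΨ⟩

end Intertwining

end AsympIntertwining

open AsympIntertwining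

/-- If `φ : A → B` and `ψ : B → A` are extendible ⋆-homomorphisms between
separable C⋆-algebras such that `ψ ∘ φ` is asymptotically unitarily equivalent to `id_A` and
`φ ∘ ψ` is asymptotically unitarily equivalent to `id_B`, then there is a ⋆-isomorphism
`Φ : A ≃ B` asymptotically unitarily equivalent to `φ`, whose inverse is asymptotically
unitarily equivalent to `ψ`. -/
theorem stmt3 {A B : Type*}
    [NonUnitalCStarAlgebra A] [PartialOrder A] [StarOrderedRing A]
    [NonUnitalCStarAlgebra B] [PartialOrder B] [StarOrderedRing B]
    [TopologicalSpace.SeparableSpace A] [TopologicalSpace.SeparableSpace B]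
    (φ : A →⋆ₙₐ[ℂ] B) (ψ : B →⋆ₙₐ[ℂ] A)
    (hφ : Extendible φ) (hψ : Extendible ψ)
    (h1 : AsympUnitaryEquiv (fun a => ψ (φ a)) (id : A → A))
    (h2 : AsympUnitaryEquiv (fun b => φ (ψ b)) (id : B → B)) :
    ∃ Φ : A ≃⋆ₐ[ℂ] B,
      AsympUnitaryEquiv (⇑Φ) (⇑φ) ∧ AsympUnitaryEquiv (⇑Φ.symm) (⇑ψ) := by
  obtain ⟨u, hu, hu_lim⟩ := asympUnitaryEquiv_iff.1 h1
  obtain ⟨v, hv, hv_lim⟩ := asympUnitaryEquiv_iff.1 h2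
  obtain ⟨Eφ, hEφ, hEφ_cont⟩ := exists_unitary_extension_of_extendible hφ
  obtain ⟨Eψ, hEψ, hEψ_cont⟩ := exists_unitary_extension_of_extendible hψ
  have hnorm : ∀ x, ‖φ x‖ = ‖x‖ := fun x => by
    refine le_antisymm (NonUnitalStarAlgHom.norm_apply_le φ x) ?_
    refine le_of_tendsto (hu_lim x).norm (Eventually.of_forall fun t => ?_)
    rw [norm_conj]
    exact NonUnitalStarAlgHom.norm_apply_le ψ (φ x)
  obtain ⟨a, ha⟩ := TopologicalSpace.exists_dense_seq A
  obtain ⟨b, hb⟩ := TopologicalSpace.exists_dense_seq B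
  obtain ⟨V, z, F, h⟩ := exists_isIntertwiningSequence (φ := φ)
    (fun F G ε hε => exists_almost_commuting_path (hEφ_cont u hu) hv (fun t => hEφ (u t))
      hu_lim hv_lim F G hε) a b
  obtain ⟨w, Φ, hw, hwΦ⟩ := exists_starAlgEquiv_of_isIntertwiningSequence hnorm ha hb h
  have hstar : ∀ y, Tendsto (fun t => conj (star (w t)) y) atTop (𝓝 (φ (Φ.symm y))) := fun y => by
    have h3 := tendsto_iff_norm_sub_tendsto_zero.1 (hwΦ (Φ.symm y))
    rw [StarAlgEquiv.apply_symm_apply] at h3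
    refine tendsto_iff_norm_sub_tendsto_zero.2 (h3.congr fun t => ?_)
    rw [norm_conj_star_sub]
  refine ⟨Φ, asympUnitaryEquiv_iff.2 ⟨fun t => star (w t), hw.star, fun x => ?_⟩,
    asympUnitaryEquiv_iff.2 ⟨fun t => star (u t * Eψ (star (w t))),
      (hu.mul (hEψ_cont _ hw.star)).star, fun y => ?_⟩⟩
  · simpa only [StarAlgEquiv.symm_apply_apply] using hstar (Φ x)
  · refine tendsto_iff_norm_sub_tendsto_zero.2 ?_
    simp only [norm_conj_star_sub, AsympIntertwining.conj_mul, hEψ]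
    have h3 : Tendsto (fun t => ‖conj (star (w t)) y - φ (Φ.symm y)‖ +
        ‖conj (u t) (ψ (φ (Φ.symm y))) - Φ.symm y‖) atTop (𝓝 (0 + 0)) :=
      (tendsto_iff_norm_sub_tendsto_zero.1 (hstar y)).add
        (tendsto_iff_norm_sub_tendsto_zero.1 (hu_lim (Φ.symm y)))
    rw [add_zero] at h3
    refine squeeze_zero (fun t => norm_nonneg _) (fun t => ?_) h3
    rw [← sub_add_sub_cancel _ (conj (u t) (ψ (φ (Φ.symm y))))]
    refine (norm_add_le _ _).trans (add_le_add ?_ le_rfl)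
    rw [norm_conj_sub_conj, ← map_sub]
    exact NonUnitalStarAlgHom.norm_apply_le ψ _
end

section
/- Let Γ be a countable discrete group, let A and B be separable unital C*-algebras with actions α: Γ → Aut(A) and β: Γ → Aut(B), and let (φ, v): (A, α) → (B, β) be a cocycle morphism with φ injective. Then (φ, v) is approximately unitarily equivalent to a cocycle conjugacy if and only if: for every ε > 0, every finite set K ⊆ Γ containing 1, and all finite sets F ⊆ A and G ⊆ B, there exists a unitary z ∈ U(B) such that ‖β_g(z) v_g φ(a) z* − v_g φ(a)‖ ≤ ε for all g ∈ K and a ∈ F, and dist(β_g(z)* b z, {v_g φ(a) : a ∈ A}) ≤ ε for all g ∈ K and b ∈ G. -/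
open Filter Topology

open CStarRing in
lemma norm_unitary_mul_mul_star_sub {B : Type*} [CStarAlgebra B] (p q : unitary B) (x y : B) :
    ‖(p : B) * x * star (q : B) - y‖ = ‖x - star (p : B) * y * (q : B)‖ := by
  have h : (p : B) * x * star (q : B) - y = p * (x - star (p : B) * y * (q : B)) * star q := by
    simp [mul_sub, sub_mul, mul_assoc]
    simp [← mul_assoc]
  rw [h, ← Unitary.coe_star, norm_mul_coe_unitary, norm_coe_unitary_mul]

lemma continuous_starAlgEquiv {B : Type*} [CStarAlgebra B] (e : B ≃⋆ₐ[ℂ] B) : Continuous e :=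
  (NonUnitalStarAlgHom.isometry e e.injective).continuous

/-- Passing from `u` to `u * z` changes the conjugated maps by as much as `z` moves the
original ones. -/
lemma norm_cocycle_conj_mul_sub {B : Type*} [CStarAlgebra B] (e : B ≃⋆ₐ[ℂ] B) (u z : unitary B)
    (x y : B) :
    ‖e ((u * z : unitary B) : B) * x * y * star ((u * z : unitary B) : B)
        - e u * x * y * star (u : B)‖ = ‖e z * x * y * star (z : B) - x * y‖ := by
  have h := norm_unitary_mul_mul_star_sub ⟨_, Unitary.map_mem e u.2⟩ u
    (e z * x * y * star (z : B)) (e u * x * y * star (u : B))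
  have h1 : star (e u) * e u = 1 := by simp [← map_star, ← map_mul]
  convert h using 2
  · simp [mul_assoc]
  · congr 1
    simp only [mul_assoc, Unitary.coe_star_mul_self, mul_one]
    simp only [← mul_assoc, h1, one_mul]

lemma cauchySeq_and_norm_sub_le_of_le_geometric {B : Type*} [NormedAddCommGroup B] {f : ℕ → B}
    {N : ℕ} (h : ∀ n, N ≤ n → ‖f (n + 1) - f n‖ ≤ (1 / 2 : ℝ) ^ n) :
    CauchySeq f ∧ ∀ L, Tendsto f atTop (𝓝 L) → ∀ n, N ≤ n → ‖f n - L‖ ≤ 2 * (1 / 2 : ℝ) ^ n := by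
  have key (m : ℕ) (hm : N ≤ m) (k : ℕ) :
      dist (f (k + m)) (f (k + 1 + m)) ≤ (1 / 2 : ℝ) ^ m * (1 / 2) ^ k := by
    rw [dist_comm, dist_eq_norm, ← pow_add, add_comm m, add_right_comm]
    exact h _ (hm.trans (Nat.le_add_left _ _))
  refine ⟨(cauchySeq_shift N).1 (cauchySeq_of_le_geometric _ _ (by norm_num) (key N le_rfl)),
    fun L hL n hn => ?_⟩
  have := dist_le_of_le_geometric_of_tendsto₀ _ _ (by norm_num) (key n hn)
    ((tendsto_add_atTop_iff_nat n).2 hL)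
  rw [zero_add, dist_eq_norm] at this
  exact this.trans_eq (by ring)

/-- A pointwise limit of ⋆-homomorphisms is a ⋆-homomorphism. -/
lemma exists_nonUnitalStarAlgHom_of_tendsto {A B : Type*} [CStarAlgebra A] [CStarAlgebra B]
    (T : ℕ → A →⋆ₙₐ[ℂ] B) (L : A → B) (hL : ∀ a, Tendsto (fun n => T n a) atTop (𝓝 (L a))) :
    ∃ Φ : A →⋆ₙₐ[ℂ] B, ⇑Φ = L :=
  ⟨{ toFun := L
     map_smul' := fun c a => tendsto_nhds_unique (hL _) (by simpa using (hL a).const_smul c)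
     map_zero' := tendsto_nhds_unique (hL _) (by simp)
     map_add' := fun a b => tendsto_nhds_unique (hL _) (by simpa using (hL a).add (hL b))
     map_mul' := fun a b => tendsto_nhds_unique (hL _) (by simpa using (hL a).mul (hL b))
     map_star' := fun a => tendsto_nhds_unique (hL _) (by simpa [map_star] using (hL a).star) },
    rfl⟩

/-- A sequence of ⋆-homomorphisms that is Cauchy on a dense set converges pointwise to a
⋆-homomorphism. -/
lemma exists_tendsto_of_cauchySeq_dense {A B : Type*} [CStarAlgebra A] [CStarAlgebra B]
    (T : ℕ → A →⋆ₙₐ[ℂ] B) {s : Set A} (hs : Dense s)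
    (hT : ∀ a ∈ s, CauchySeq fun n => T n a) :
    ∃ Φ : A →⋆ₙₐ[ℂ] B, ∀ a, Tendsto (fun n => T n a) atTop (𝓝 (Φ a)) := by
  have hc (a : A) : CauchySeq fun n => T n a := by
    refine Metric.cauchySeq_iff.2 fun ε hε => ?_
    obtain ⟨x, hx, hxa⟩ := hs.exists_dist_lt a (show 0 < ε / 3 by positivity)
    obtain ⟨N, hN⟩ := Metric.cauchySeq_iff.1 (hT x hx) (ε / 3) (by positivity)
    refine ⟨N, fun m hm n hn => ?_⟩
    have key (k : ℕ) : dist (T k a) (T k x) ≤ dist a x := by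
      rw [dist_eq_norm, dist_eq_norm, ← map_sub]
      exact NonUnitalStarAlgHom.norm_apply_le _ _
    have h1 := dist_triangle4 (T m a) (T m x) (T n x) (T n a)
    have h2 := key n
    rw [dist_comm] at h2
    linarith [key m, hN m hm n hn]
  choose L hL using fun a => cauchySeq_tendsto_of_complete (hc a)
  obtain ⟨Φ, rfl⟩ := exists_nonUnitalStarAlgHom_of_tendsto T L hL
  exact ⟨Φ, hL⟩

/-- The unitaries of the criterion can be multiplied up to a sequence along which the
conjugates of `(φ, v)` converge fast on increasing finite sets, while the ranges of the conjugates
of `φ` exhaust a given sequence in `B`. -/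
lemma exists_intertwining_sequence {Γ A B : Type*} [Group Γ] [CStarAlgebra A] [CStarAlgebra B]
    {β : Γ → B ≃⋆ₐ[ℂ] B} (hβ : ∀ b, β 1 b = b) {φ : A →⋆ₙₐ[ℂ] B} {v : Γ → unitary B}
    (hv : v 1 = 1)
    (H : ∀ ε : ℝ, 0 < ε → ∀ K : Finset Γ, (1 : Γ) ∈ K → ∀ (F : Finset A) (G : Finset B),
        ∃ z : unitary B,
          (∀ g ∈ K, ∀ a ∈ F,
            ‖β g (z : B) * (v g : B) * φ a * star ((z : B)) - (v g : B) * φ a‖ ≤ ε) ∧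
          (∀ g ∈ K, ∀ b ∈ G,
            Metric.infDist (star (β g (z : B)) * b * (z : B))
              (Set.range fun a : A => (v g : B) * φ a) ≤ ε))
    (K : ℕ → Finset Γ) (hK : ∀ n, 1 ∈ K n) (a : ℕ → A) (b : ℕ → B) :
    ∃ (u : ℕ → unitary B) (S : ℕ → Finset A), Monotone S ∧ 1 ∈ S 0 ∧ (∀ n, a n ∈ S (n + 1)) ∧
      (∀ n, ∀ g ∈ K n, ∀ x ∈ S n, ‖β g (u (n + 1)) * v g * φ x * star (u (n + 1) : B)
        - β g (u n) * v g * φ x * star (u n : B)‖ ≤ (1 / 2 : ℝ) ^ n) ∧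
      ∀ n, ∀ i ≤ n, ∃ x ∈ S (n + 1),
        ‖(u (n + 1) : B) * φ x * star (u (n + 1) : B) - b i‖ ≤ (1 / 2 : ℝ) ^ n := by
  classical
  have step (n : ℕ) (p : unitary B × Finset A) : ∃ q : unitary B × Finset A,
      p.2 ⊆ q.2 ∧ a n ∈ q.2 ∧
      (∀ g ∈ K n, ∀ x ∈ p.2, ‖β g q.1 * v g * φ x * star (q.1 : B)
        - β g p.1 * v g * φ x * star (p.1 : B)‖ ≤ (1 / 2 : ℝ) ^ n) ∧
      ∀ i ≤ n, ∃ x ∈ q.2, ‖(q.1 : B) * φ x * star (q.1 : B) - b i‖ ≤ (1 / 2 : ℝ) ^ n := by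
    obtain ⟨u, S⟩ := p
    have hlt : (1 / 2 : ℝ) ^ (n + 1) < (1 / 2 : ℝ) ^ n := by
      rw [pow_succ]
      linarith [show (0 : ℝ) < (1 / 2 : ℝ) ^ n by positivity]
    obtain ⟨z, hz1, hz2⟩ := H ((1 / 2 : ℝ) ^ (n + 1)) (by positivity) (K n) (hK n) S
      ((Finset.range (n + 1)).image fun i => star (u : B) * b i * (u : B))
    have hx (i : ℕ) : ∃ x : A, i ≤ n →
        ‖((u * z : unitary B) : B) * φ x * star ((u * z : unitary B) : B) - b i‖
          ≤ (1 / 2 : ℝ) ^ n := by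
      by_cases hi : i ≤ n
      · have := (hz2 1 (hK n) _ (Finset.mem_image_of_mem _
          (Finset.mem_range.2 (Nat.lt_succ_of_le hi)))).trans_lt hlt
        obtain ⟨_, ⟨x, rfl⟩, hx⟩ := (Metric.infDist_lt_iff (Set.range_nonempty _)).1 this
        refine ⟨x, fun _ => ?_⟩
        rw [norm_unitary_mul_mul_star_sub, norm_sub_rev, ← dist_eq_norm]
        simpa [hβ, hv, mul_assoc] using hx.le
      · exact ⟨0, fun h => absurd h hi⟩
    choose x hx using hx
    refine ⟨(u * z, insert (a n) (S ∪ (Finset.range (n + 1)).image x)), ?_, ?_, ?_, ?_⟩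
    · exact Finset.subset_union_left.trans (Finset.subset_insert _ _)
    · exact Finset.mem_insert_self _ _
    · intro g hg y hy
      rw [norm_cocycle_conj_mul_sub]
      exact (hz1 g hg y hy).trans hlt.le
    · intro i hi
      exact ⟨x i, Finset.mem_insert_of_mem (Finset.mem_union_right _ (Finset.mem_image_of_mem _
        (Finset.mem_range.2 (Nat.lt_succ_of_le hi)))), hx i hi⟩
  choose f hf using step
  let p : ℕ → unitary B × Finset A := fun n => Nat.rec (1, {1}) f n
  exact ⟨fun n => (p n).1, fun n => (p n).2, monotone_nat_of_le_succ fun n => (hf n (p n)).1,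
    Finset.mem_singleton_self _, fun n => (hf n (p n)).2.1, fun n => (hf n (p n)).2.2.1,
    fun n => (hf n (p n)).2.2.2⟩

/-- If conjugation by `u n` carries `φ` to an isomorphism and the conjugated cocycles converge,
then the limit is a cocycle conjugacy approximately unitarily equivalent to `(φ, v)`. -/
lemma exists_cocycle_conjugacy_of_tendsto {Γ A B : Type*} [Group Γ]
    [CStarAlgebra A] [CStarAlgebra B]
    {α : Γ → A ≃⋆ₐ[ℂ] A} {β : Γ → B ≃⋆ₐ[ℂ] B} (hβ : IsCStarAction β)
    {φ : A →⋆ₙₐ[ℂ] B} {v : Γ → unitary B} (hφv : IsCocyclePair α β (⇑φ) v)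
    {u : ℕ → unitary B} {Φ : A ≃⋆ₐ[ℂ] B}
    (hΦ : ∀ a, Tendsto (fun n => (u n : B) * φ a * star (u n : B)) atTop (𝓝 (Φ a)))
    (hV : ∀ g, CauchySeq fun n => β g (u n) * v g * star (u n : B)) :
    ∃ V : Γ → unitary B, IsCocyclePair α β (⇑Φ) V ∧
      CocycleApproxUnitaryEquiv β (⇑φ) (⇑Φ) (fun g => (v g : B)) (fun g => (V g : B)) := by
  choose W hW using fun g => cauchySeq_tendsto_of_complete (hV g)
  have hWu (g : Γ) : W g ∈ unitary B := by
    refine isClosed_unitary.mem_of_tendsto (hW g) (Eventually.of_forall fun n => ?_)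
    exact mul_mem (mul_mem (Unitary.map_mem (β g) (u n).2) (v g).2) (star (u n)).2
  have hu (n : ℕ) (x : B) : star (u n : B) * ((u n : B) * x) = x := by simp [← mul_assoc]
  refine ⟨fun g => ⟨W g, hWu g⟩, ⟨?_, fun g a => ?_, fun g h => ?_⟩, u, fun g a => ?_⟩
  · refine Subtype.ext (tendsto_nhds_unique (hW 1) ?_)
    simp [hβ.1, hφv.1]
  · refine tendsto_nhds_unique
      ((((continuous_starAlgEquiv (β g)).tendsto _).comp (hΦ a)).mul (hW g))
      (((hW g).mul (hΦ (α g a))).congr fun n => ?_)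
    have h1 : star (β g (u n)) * β g (u n) = 1 := by simp [← map_star, ← map_mul]
    have h2 (x : B) : star (β g (u n)) * (β g (u n) * x) = x := by rw [← mul_assoc, h1, one_mul]
    have h3 (x : B) : (v g : B) * (φ (α g a) * x) = β g (φ a) * (v g * x) := by
      rw [← mul_assoc, ← hφv.2.1, mul_assoc]
    simp only [Function.comp_apply, map_mul, map_star, mul_assoc, hu, h2, h3]
  · refine tendsto_nhds_unique (hW (g * h)) (((((continuous_starAlgEquiv (β g)).tendsto _).comp
      (hW h)).mul (hW g)).congr fun n => ?_)
    have h1 : star (β g (u n)) * β g (u n) = 1 := by simp [← map_star, ← map_mul]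
    have h2 (x : B) : star (β g (u n)) * (β g (u n) * x) = x := by rw [← mul_assoc, h1, one_mul]
    simp only [Function.comp_apply, map_mul, map_star, mul_assoc, h2, hβ.2, hφv.2.2]
  · refine tendsto_iff_norm_sub_tendsto_zero.1 (((hW g).mul (hΦ a)).congr fun n => ?_)
    simp only [mul_assoc, hu]

/-- Approximate unitary equivalence to a cocycle conjugacy yields the unitaries of the
intertwining criterion, in the form `star (u m) * u n` with `m` and then `n` large. -/
lemma exists_unitary_of_approxUnitaryEquiv {Γ A B : Type*} [CStarAlgebra A] [CStarAlgebra B]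
    [Group Γ] {β : Γ → B ≃⋆ₐ[ℂ] B} {φ : A →⋆ₙₐ[ℂ] B} {v V : Γ → unitary B} {Φ : A ≃⋆ₐ[ℂ] B}
    (h : CocycleApproxUnitaryEquiv β (⇑φ) (⇑Φ) (fun g => (v g : B)) (fun g => (V g : B)))
    {ε : ℝ} (hε : 0 < ε) (K : Finset Γ) (F : Finset A) (G : Finset B) :
    ∃ z : unitary B,
      (∀ g ∈ K, ∀ a ∈ F,
        ‖β g (z : B) * (v g : B) * φ a * star ((z : B)) - (v g : B) * φ a‖ ≤ ε) ∧
      (∀ g ∈ K, ∀ b ∈ G,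
        Metric.infDist (star (β g (z : B)) * b * (z : B))
          (Set.range fun a : A => (v g : B) * φ a) ≤ ε) := by
  obtain ⟨u, hu⟩ := h
  have ev (δ : ℝ) (hδ : 0 < δ) (F : Finset A) : ∀ᶠ n in atTop, ∀ g ∈ K, ∀ a ∈ F,
      ‖β g (u n) * v g * φ a * star (u n : B) - V g * Φ a‖ < δ := by
    simp only [Finset.eventually_all]
    exact fun g _ a _ => (hu g a).eventually_lt_const hδ
  classical
  obtain ⟨m, hm⟩ := (ev (ε / 2) (by positivity) F).exists
  let a' : Γ → B → A := fun g b => Φ.symm (star (V g : B) * (β g (u m) * b * star (u m : B)))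
  have ha' (g : Γ) (b : B) : V g * Φ (a' g b) = β g (u m) * b * star (u m : B) := by
    simp [a', ← mul_assoc]
  obtain ⟨n, hn, hn'⟩ := ((ev (ε / 2) (by positivity) F).and
    (ev ε hε ((K ×ˢ G).image fun p => a' p.1 p.2))).exists
  refine ⟨star (u m) * u n, fun g hg a ha => ?_, fun g hg b hb => ?_⟩
  · have key := norm_unitary_mul_mul_star_sub ⟨_, Unitary.map_mem (β g) (u m).2⟩ (u m)
      (v g * φ a) (β g (u n) * v g * φ a * star (u n : B))
    have h1 := norm_sub_le_norm_sub_add_norm_sub (β g (u m) * v g * φ a * star (u m : B))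
      (V g * Φ a) (β g (u n) * v g * φ a * star (u n : B))
    have h2 := hn g hg a ha
    rw [norm_sub_rev] at h2
    rw [norm_sub_rev]
    simp only [mul_assoc, Unitary.coe_star, map_star, map_mul, star_mul, star_star,
      Submonoid.coe_mul] at key h1 h2 ⊢
    have h3 := hm g hg a ha
    simp only [mul_assoc] at h3
    linarith
  · refine (Metric.infDist_le_dist_of_mem (Set.mem_range_self (a' g b))).trans ?_
    have h2 := hn' g hg (a' g b) (Finset.mem_image.2 ⟨(g, b), Finset.mk_mem_product hg hb, rfl⟩)
    have key := norm_unitary_mul_mul_star_sub ⟨_, Unitary.map_mem (β g) (u n).2⟩ (u n)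
      (v g * φ (a' g b)) (β g (u m) * b * star (u m : B))
    rw [ha'] at h2
    rw [dist_comm, dist_eq_norm]
    simp only [mul_assoc, Unitary.coe_star, map_star, map_mul, star_mul, star_star,
      Submonoid.coe_mul] at key h2 ⊢
    linarith

/-- A one-sided intertwining criterion: an injective cocycle morphism `(φ, v)`
is approximately unitarily equivalent to a cocycle conjugacy iff for all tolerances `ε`, finite
`K ⊆ Γ` with `1 ∈ K`, and finite `F ⊆ A`, `G ⊆ B`, there is a unitary `z ∈ U(B)` almost
commuting with the maps `a ↦ v g φ(a)` and almost conjugating `G` into their ranges. -/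
theorem stmt4 {Γ A B : Type*} [Group Γ] [Countable Γ]
    [CStarAlgebra A] [CStarAlgebra B]
    [TopologicalSpace.SeparableSpace A] [TopologicalSpace.SeparableSpace B]
    (α : Γ → A ≃⋆ₐ[ℂ] A) (β : Γ → B ≃⋆ₐ[ℂ] B)
    (hα : IsCStarAction α) (hβ : IsCStarAction β)
    (φ : A →⋆ₙₐ[ℂ] B) (v : Γ → unitary B) (hφv : IsCocyclePair α β (⇑φ) v)
    (hinj : Function.Injective φ) :
    (∃ (Φ : A ≃⋆ₐ[ℂ] B) (V : Γ → unitary B),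
        IsCocyclePair α β (⇑Φ) V ∧
        CocycleApproxUnitaryEquiv β (⇑φ) (⇑Φ) (fun g => (v g : B)) (fun g => (V g : B))) ↔
      (∀ ε : ℝ, 0 < ε → ∀ K : Finset Γ, (1 : Γ) ∈ K → ∀ (F : Finset A) (G : Finset B),
        ∃ z : unitary B,
          (∀ g ∈ K, ∀ a ∈ F,
            ‖β g (z : B) * (v g : B) * φ a * star ((z : B)) - (v g : B) * φ a‖ ≤ ε) ∧
          (∀ g ∈ K, ∀ b ∈ G,
            Metric.infDist (star (β g (z : B)) * b * (z : B))
              (Set.range fun a : A => (v g : B) * φ a) ≤ ε)) := by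
  refine ⟨fun ⟨Φ, V, _, h⟩ ε hε K _ F G => exists_unitary_of_approxUnitaryEquiv h hε K F G,
    fun H => ?_⟩
  classical
  obtain ⟨e, he⟩ := exists_surjective_nat Γ
  have hb := TopologicalSpace.denseRange_denseSeq B
  obtain ⟨u, S, hS, h1S, haS, hstep, hsurj⟩ := exists_intertwining_sequence hβ.1 hφv.1 H
    (fun n => insert 1 ((Finset.range n).image e)) (fun n => Finset.mem_insert_self _ _)
    (TopologicalSpace.denseSeq A) (TopologicalSpace.denseSeq B)
  have hstep1 (n : ℕ) (x : A) (hx : x ∈ S n) (k : ℕ) (hk : n ≤ k) :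
      ‖(u (k + 1) : B) * φ x * star (u (k + 1) : B) - (u k : B) * φ x * star (u k : B)‖
        ≤ (1 / 2 : ℝ) ^ k := by
    simpa [hβ.1, hφv.1] using hstep k 1 (Finset.mem_insert_self _ _) x (hS hk hx)
  obtain ⟨Ψ, hΨ⟩ : ∃ Ψ : A →⋆ₙₐ[ℂ] B,
      ∀ a, Tendsto (fun n => (u n : B) * φ a * star (u n : B)) atTop (𝓝 (Ψ a)) := by
    refine exists_tendsto_of_cauchySeq_dense
      (fun n => (Unitary.conjStarAlgAut ℂ B (u n) : B →⋆ₙₐ[ℂ] B).comp φ)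
      (TopologicalSpace.denseRange_denseSeq A) ?_
    rintro _ ⟨i, rfl⟩
    exact (cauchySeq_and_norm_sub_le_of_le_geometric (hstep1 (i + 1) _ (haS i))).1
  have hnorm (a : A) : ‖Ψ a‖ = ‖a‖ := by
    refine tendsto_nhds_unique (hΨ a).norm (tendsto_const_nhds.congr fun n => ?_)
    rw [← Unitary.coe_star, CStarRing.norm_mul_coe_unitary, CStarRing.norm_coe_unitary_mul,
      NonUnitalStarAlgHom.norm_map φ hinj]
  have hiso : Isometry Ψ := AddMonoidHomClass.isometry_of_norm Ψ hnorm
  have hbij : Function.Bijective Ψ := by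
    refine ⟨hiso.injective, fun b => ?_⟩
    suffices h : ∀ i, TopologicalSpace.denseSeq B i ∈ Set.range Ψ from
      (hiso.isClosedEmbedding.isClosed_range.closure_subset_iff.2
        (Set.range_subset_iff.2 h)) (hb b)
    intro i
    rw [← hiso.isClosedEmbedding.isClosed_range.closure_eq]
    refine Metric.mem_closure_iff.2 fun ε hε => ?_
    obtain ⟨N, hN⟩ := exists_pow_lt_of_lt_one (show 0 < ε / 2 by positivity)
      (show (1 / 2 : ℝ) < 1 by norm_num)
    obtain ⟨x, hx, hxb⟩ := hsurj (max i N) i (le_max_left _ _)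
    have h1 := (cauchySeq_and_norm_sub_le_of_le_geometric (hstep1 _ x hx)).2 _ (hΨ x) _ le_rfl
    have h2 : (1 / 2 : ℝ) ^ (max i N) ≤ (1 / 2 : ℝ) ^ N :=
      pow_le_pow_of_le_one (by norm_num) (by norm_num) (le_max_right _ _)
    refine ⟨Ψ x, Set.mem_range_self x, ?_⟩
    rw [pow_succ] at h1
    rw [norm_sub_rev] at hxb
    rw [dist_eq_norm]
    refine (norm_sub_le_norm_sub_add_norm_sub _ _ _).trans_lt
      ((add_le_add hxb h1).trans_lt ?_)
    linarith
  have hφ1 : φ 1 = 1 := by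
    have h1 : Ψ 1 = 1 := map_one (StarAlgEquiv.ofBijective Ψ hbij)
    have h2 := ((hΨ 1).sub_const 1).norm
    rw [h1, sub_self, norm_zero] at h2
    refine sub_eq_zero.1 (norm_eq_zero.1 (tendsto_nhds_unique (tendsto_const_nhds.congr
      fun n => ?_) h2))
    rw [norm_unitary_mul_mul_star_sub]
    simp
  have hV (g : Γ) : CauchySeq fun n => β g (u n) * v g * star (u n : B) := by
    obtain ⟨N, rfl⟩ := he g
    refine (cauchySeq_and_norm_sub_le_of_le_geometric (N := N + 1) fun n hn => ?_).1
    simpa [hφ1] using hstep n (e N) (Finset.mem_insert_of_mem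
      (Finset.mem_image_of_mem _ (Finset.mem_range.2 hn))) 1 (hS (Nat.zero_le n) h1S)
  obtain ⟨V, hV⟩ := exists_cocycle_conjugacy_of_tendsto hβ hφv
    (Φ := StarAlgEquiv.ofBijective Ψ hbij) hΨ hV
  exact ⟨_, V, hV⟩
end
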